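/- arXiv:0706.1738 — 5 statements merged into one kernel-verified Lean document; each statement's English description precedes it below -/
import Mathlib

section
/- For every positive integer n there exists a bijection Φ from the symmetric group S_n to itself such that for every permutation π of [n]: fix Φ(π) = fix π, exc Φ(π) = exc π, and DEZ Φ(π) = DES π. In particular, the triples of statistics (fix, exc, DEZ) and (fix, exc, DES) are equidistributed on S_n. -/
/-- The value of a permutation of `[n] = {1, …, n}` at `i`, in 1-based terms:
for `1 ≤ i ≤ n` this is `σ(i) ∈ {1, …, n}`; outside `[n]` we return `i`. -/
def permToFun {n : ℕ} (σ : Equiv.Perm (Fin n)) (i : ℕ) : ℕ :=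
  if h : 1 ≤ i ∧ i ≤ n then ((σ ⟨i - 1, by omega⟩ : Fin n) : ℕ) + 1 else i

/-- `fix σ`: the number of fixed points of a permutation of `[n]`. -/
def fixCount {n : ℕ} (σ : Equiv.Perm (Fin n)) : ℕ :=
  ((Finset.Icc 1 n).filter fun i => permToFun σ i = i).card

/-- `exc σ`: the number of excedances of a permutation of `[n]`. -/
def excCount {n : ℕ} (σ : Equiv.Perm (Fin n)) : ℕ :=
  ((Finset.Icc 1 n).filter fun i => i < permToFun σ i).card

/-- `DES σ`: the descent set of a permutation of `[n]`, a subset of `[n-1]`. -/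
def desSet {n : ℕ} (σ : Equiv.Perm (Fin n)) : Finset ℕ :=
  (Finset.Icc 1 (n - 1)).filter fun i => permToFun σ (i + 1) < permToFun σ i

/-- The word `σ⁰`, where each fixed point value is replaced by `0` (1-based positions). -/
def zeroWord {n : ℕ} (σ : Equiv.Perm (Fin n)) (i : ℕ) : ℕ :=
  if permToFun σ i = i then 0 else permToFun σ i

/-- `DEZ σ = DES σ⁰`, a subset of `[n-1]`. -/
def dezSet {n : ℕ} (σ : Equiv.Perm (Fin n)) : Finset ℕ :=
  (Finset.Icc 1 (n - 1)).filter fun i => zeroWord σ (i + 1) < zeroWord σ i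

open Finset Equiv

/-- Within each level set of `b`, the word of `σ` has no descent at adjacent positions. -/
def BlockAscending {n : ℕ} (b : Fin n → ℕ) (σ : Perm (Fin n)) : Prop :=
  ∀ i j : Fin n, (j : ℕ) = i + 1 → b i = b j → σ i < σ j

/-- Within each level set of `b`, the word of `σ` with its fixed points replaced by `0` has no
descent at adjacent positions. -/
def ZeroBlockAscending {n : ℕ} (b : Fin n → ℕ) (σ : Perm (Fin n)) : Prop :=
  ∀ i j : Fin n, (j : ℕ) = i + 1 → b i = b j → σ i = i ∨ (σ j ≠ j ∧ σ i < σ j)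

/-- `τ` arises from `σ` by moving fixed points inside the level sets of `b`, keeping the relative
order of all other points. -/
def FixShift {n : ℕ} (b : Fin n → ℕ) (σ τ : Perm (Fin n)) : Prop :=
  ∃ p : Perm (Fin n), (∀ i, τ (p i) = p (σ i)) ∧ (∀ i, b (p i) = b i) ∧
    ∀ i j, σ i ≠ i → σ j ≠ j → i < j → p i < p j

section Rearrangement

variable {n : ℕ} {b : Fin n → ℕ} {σ τ ρ : Perm (Fin n)}

theorem FixShift.symm (h : FixShift b σ τ) : FixShift b τ σ := by
  obtain ⟨p, hc, hb, hm⟩ := h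
  refine ⟨p⁻¹, fun i => ?_, fun i => ?_, fun i j hi hj hij => ?_⟩
  · obtain ⟨i, rfl⟩ := p.surjective i
    simp [hc]
  · obtain ⟨i, rfl⟩ := p.surjective i
    simp [hb]
  · obtain ⟨i, rfl⟩ := p.surjective i
    obtain ⟨j, rfl⟩ := p.surjective j
    rw [hc, p.injective.ne_iff] at hi hj
    simp only [Perm.coe_inv, symm_apply_apply]
    by_contra! hji
    rcases hji.lt_or_eq with h | h
    · exact (hm j i hj hi h).asymm hij
    · exact hij.ne (by rw [h])

theorem FixShift.trans (h : FixShift b σ τ) (h' : FixShift b τ ρ) : FixShift b σ ρ := by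
  obtain ⟨p, hc, hb, hm⟩ := h
  obtain ⟨q, hc', hb', hm'⟩ := h'
  refine ⟨q * p, fun i => by simp [hc, hc'], fun i => by simp [hb, hb'],
    fun i j hi hj hij => hm' _ _ ?_ ?_ (hm i j hi hj hij)⟩
  · rwa [hc, p.injective.ne_iff]
  · rwa [hc, p.injective.ne_iff]

theorem permToFun_succ (σ : Perm (Fin n)) (i : Fin n) :
    permToFun σ (i + 1) = σ i + 1 := by
  simp [permToFun]

theorem card_filter_Icc_eq (q : ℕ → Prop) [DecidablePred q] :
    #{k ∈ Icc 1 n | q k} = #{i : Fin n | q (i + 1)} := by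
  symm
  refine card_bij (fun i _ => (i : ℕ) + 1) (fun i hi => ?_)
    (fun i _ j _ h => Fin.ext (by omega)) fun k hk => ?_
  · simpa [Nat.succ_le_iff] using hi
  · rw [mem_filter, mem_Icc] at hk
    have hk' : k - 1 + 1 = k := by omega
    exact ⟨⟨k - 1, by omega⟩, by simpa [hk'] using hk.2, hk'⟩

theorem fixCount_eq (σ : Perm (Fin n)) : fixCount σ = #{i | σ i = i} := by
  simp [fixCount, card_filter_Icc_eq, permToFun_succ, Fin.ext_iff]

theorem excCount_eq (σ : Perm (Fin n)) : excCount σ = #{i | i < σ i} := by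
  simp [excCount, card_filter_Icc_eq, permToFun_succ]

theorem FixShift.fixCount_eq (h : FixShift b σ τ) : fixCount τ = fixCount σ := by
  obtain ⟨p, hc, -, -⟩ := h
  rw [_root_.fixCount_eq, _root_.fixCount_eq]
  symm
  exact card_equiv p fun i => by simp [hc]

theorem lt_apply_iff_of_fixShift {p : Perm (Fin n)}
    (hm : ∀ i j, σ i ≠ i → σ j ≠ j → i < j → p i < p j) (i : Fin n) :
    p i < p (σ i) ↔ i < σ i := by
  by_cases hi : σ i = i
  · simp [hi]
  have hi' : σ (σ i) ≠ σ i := σ.injective.ne hi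
  refine ⟨fun h => ?_, hm _ _ hi hi'⟩
  by_contra! hle
  exact (hm _ _ hi' hi (hle.lt_of_ne hi)).asymm h

theorem FixShift.excCount_eq (h : FixShift b σ τ) : excCount τ = excCount σ := by
  obtain ⟨p, hc, -, hm⟩ := h
  rw [_root_.excCount_eq, _root_.excCount_eq]
  symm
  exact card_equiv p fun i => by simp [hc, lt_apply_iff_of_fixShift hm]

/-- Stable sorting of each level set of `b` according to a key `t`. -/
theorem exists_blockwise_sort (hb : Monotone b) (t : Fin n → ℕ) :
    ∃ p : Perm (Fin n), (∀ i, b (p i) = b i) ∧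
      ∀ i j, b i = b j → (t i < t j ∨ t i = t j ∧ i < j) → p i < p j := by
  let key : Fin n → ℕ ×ₗ (ℕ ×ₗ Fin n) := fun i => toLex (b i, toLex (t i, i))
  have hkey := Tuple.monotone_sort key
  have hbs : Monotone (b ∘ Tuple.sort key) := fun i j hij =>
    (Prod.Lex.monotone_fst _ _ (hkey hij) :)
  have hcomp : b ∘ Tuple.sort key = b :=
    Tuple.unique_monotone (σ := Tuple.sort key) (τ := Equiv.refl _) hbs hb
  refine ⟨(Tuple.sort key)⁻¹, fun i => ?_, fun i j hij ht => ?_⟩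
  · have := congrFun hcomp ((Tuple.sort key)⁻¹ i)
    simpa using this.symm
  · by_contra! hle
    have h := hkey hle
    simp only [Function.comp_apply, Perm.coe_inv, apply_symm_apply] at h
    simp only [key, Prod.Lex.toLex_le_toLex, hij] at h
    rcases ht with h' | h'
    · rcases h with h | h
      · omega
      · rcases h.2 with h | h <;> omega
    · rcases h with h | h
      · omega
      · rcases h.2 with h | h
        · omega
        · exact absurd h.2 (not_le.mpr h'.2)

theorem monotoneOn_of_blockwise (hb : Monotone b) {p : Perm (Fin n)} (hp : ∀ i, b (p i) = b i)
    {i j : Fin n} (hij : i < j) (h : b i = b j → p i < p j) : p i < p j := by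
  rcases (hb hij.le).lt_or_eq with hlt | heq
  · rw [← hp i, ← hp j] at hlt
    exact hb.reflect_lt hlt
  · exact h heq

/-- A relation holding between adjacent members of a level set of `b` and transitive along it holds
between any two members. -/
theorem block_induction (hb : Monotone b) {r : Fin n → Fin n → Prop}
    (hr : ∀ i j k, i < j → j < k → r i j → r j k → r i k)
    (hadj : ∀ i j : Fin n, (j : ℕ) = i + 1 → b i = b j → r i j) {i j : Fin n} (hij : i < j)
    (hbij : b i = b j) : r i j := by
  obtain ⟨j, hj⟩ := j
  induction j with
  | zero => exact absurd hij (by simp [Fin.lt_def])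
  | succ m ih =>
    rcases Nat.lt_succ_iff_lt_or_eq.mp (Fin.lt_def.mp hij) with h | h
    · have h1 : b i ≤ b ⟨m, by omega⟩ := hb (Fin.le_def.mpr h.le)
      have h2 : b ⟨m, by omega⟩ ≤ b ⟨m + 1, hj⟩ := hb (Fin.le_def.mpr (Nat.le_succ m))
      exact hr _ ⟨m, by omega⟩ _ h (Fin.lt_def.mpr (Nat.lt_succ_self m))
        (ih (by omega) h (by omega)) (hadj _ _ rfl (by omega))
    · exact hadj _ _ (by simp [h]) hbij

theorem BlockAscending.add_le (hb : Monotone b) (h : BlockAscending b σ) {i j : Fin n}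
    (hij : i < j) (hbij : b i = b j) : (σ i : ℕ) + j ≤ σ j + i :=
  block_induction hb (r := fun i j => (σ i : ℕ) + j ≤ σ j + i) (fun i j k _ _ _ _ => by omega)
    (fun i j hj hbij => by have := Fin.lt_def.mp (h i j hj hbij); omega) hij hbij

theorem BlockAscending.lt (hb : Monotone b) (h : BlockAscending b σ) {i j : Fin n}
    (hij : i < j) (hbij : b i = b j) : σ i < σ j := by
  have := h.add_le hb hij hbij
  simp only [Fin.lt_def] at hij ⊢
  omega

theorem ZeroBlockAscending.fixed_or_lt (hb : Monotone b) (h : ZeroBlockAscending b σ)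
    {i j : Fin n} (hij : i < j) (hbij : b i = b j) : σ i = i ∨ (σ j ≠ j ∧ σ i < σ j) :=
  block_induction hb (r := fun i j => σ i = i ∨ (σ j ≠ j ∧ σ i < σ j))
    (fun i j k _ _ hij hjk => by
      rcases hij with hij | hij
      · exact Or.inl hij
      · rcases hjk with hjk | hjk
        · exact absurd hjk hij.1
        · exact Or.inr ⟨hjk.1, hij.2.trans hjk.2⟩) h hij hbij

theorem BlockAscending.exists_fixShift (hb : Monotone b) (h : BlockAscending b σ) :
    ∃ τ, FixShift b σ τ ∧ ZeroBlockAscending b τ := by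
  obtain ⟨p, hp, hs⟩ := exists_blockwise_sort hb fun i => if σ i = i then 0 else 1
  have hm : ∀ i j, σ i ≠ i → σ j ≠ j → i < j → p i < p j := fun i j hi hj hij =>
    monotoneOn_of_blockwise hb hp hij fun hbij => hs i j hbij (Or.inr (by simp [hi, hj, hij]))
  refine ⟨p * σ * p⁻¹, ⟨p, by simp, hp, hm⟩, fun i j hij hbij => ?_⟩
  obtain ⟨i, rfl⟩ := p.surjective i
  obtain ⟨j, rfl⟩ := p.surjective j
  rw [hp, hp] at hbij
  have hlt : p i < p j := Fin.lt_def.mpr (by omega)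
  simp only [Perm.mul_apply, Perm.coe_inv, symm_apply_apply, EmbeddingLike.apply_eq_iff_eq,
    ne_eq]
  by_cases hi : σ i = i
  · exact Or.inl hi
  have hj : σ j ≠ j := fun hj => (hs j i hbij.symm (Or.inl (by simp [hi, hj]))).asymm hlt
  have hij' : i < j := by
    by_contra! hle
    rcases hle.lt_or_eq with h' | h'
    · exact (hm j i hj hi h').asymm hlt
    · exact hlt.ne (by rw [h'])
  exact Or.inr ⟨hj, hm _ _ (σ.injective.ne hi) (σ.injective.ne hj) (h.lt hb hij' hbij)⟩

theorem ZeroBlockAscending.lt_apply (hb : Monotone b) (h : ZeroBlockAscending b σ)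
    {i j : Fin n} (hij : i < j) (hbij : b i = b j) (hi : i < σ i) : j < σ j :=
  block_induction hb (r := fun i j => i < σ i → j < σ j) (fun _ _ _ _ _ hij hjk => hjk ∘ hij)
    (fun i j hij hbij hi => by
      have := ((h i j hij hbij).resolve_left hi.ne').2
      simp only [Fin.lt_def] at *
      omega) hij hbij hi

theorem ZeroBlockAscending.exists_fixShift (hb : Monotone b) (h : ZeroBlockAscending b σ) :
    ∃ τ, FixShift b σ τ ∧ BlockAscending b τ := by
  obtain ⟨p, hp, hs⟩ := exists_blockwise_sort hb
    fun i => if σ i < i then 0 else if σ i = i then 1 else 2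
  have hm : ∀ i j, σ i ≠ i → σ j ≠ j → i < j → p i < p j := by
    refine fun i j hi hj hij => monotoneOn_of_blockwise hb hp hij fun hbij => hs i j hbij ?_
    have := h.lt_apply hb hij hbij
    simp only [hi, hj, if_false]
    split_ifs <;> grind
  have hlt : ∀ i, σ i < i → p (σ i) < p i := fun i hi =>
    hm _ _ (σ.injective.ne hi.ne) hi.ne hi
  have hgt : ∀ i, i < σ i → p i < p (σ i) := fun i => (lt_apply_iff_of_fixShift hm i).mpr
  refine ⟨p * σ * p⁻¹, ⟨p, by simp, hp, hm⟩, fun i j hij hbij => ?_⟩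
  obtain ⟨i, rfl⟩ := p.surjective i
  obtain ⟨j, rfl⟩ := p.surjective j
  rw [hp, hp] at hbij
  have hpij : p i < p j := Fin.lt_def.mpr (by omega)
  simp only [Perm.mul_apply, Perm.coe_inv, symm_apply_apply]
  have hs' := fun h => (hs j i hbij.symm h).asymm hpij
  have hne : i ≠ j := fun h => hpij.ne (by rw [h])
  have same : (σ i ≠ i) → (σ j ≠ j) → i < j → p (σ i) < p (σ j) := fun hi hj hij' =>
    hm _ _ (σ.injective.ne hi) (σ.injective.ne hj)
      ((h.fixed_or_lt hb hij' hbij).resolve_left hi).2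
  rcases lt_trichotomy (σ i) i with hi | hi | hi <;>
  rcases lt_trichotomy (σ j) j with hj | hj | hj
  · exact same hi.ne hj.ne (by grind)
  · exact (hlt i hi).trans (by rwa [hj])
  · exact ((hlt i hi).trans hpij).trans (hgt j hj)
  · exact absurd (Or.inl (by grind)) hs'
  · rwa [hi, hj]
  · rw [hi]
    exact hpij.trans (hgt j hj)
  · exact absurd (Or.inl (by grind)) hs'
  · exact absurd (Or.inl (by grind)) hs'
  · exact same hi.ne' hj.ne' (by grind)

/-- A permutation preserving the level sets of `b` and increasing on `S` fixes every `i` for which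
`S` and its image both contain the initial segments of the level set of `i` up to `i` and its
image. -/
theorem apply_eq_of_initial_segment {α : Type*} [LinearOrder α] [WellFoundedLT α] {b : α → ℕ}
    {S : Set α} {p : Perm α} (hb : ∀ i, b (p i) = b i)
    (hm : ∀ i ∈ S, ∀ j ∈ S, i < j → p i < p j) (i : α) (h : ∀ j ≤ i, b j = b i → j ∈ S)
    (h' : ∀ j ≤ p i, b j = b i → p.symm j ∈ S) : p i = i := by
  induction i using WellFoundedLT.induction with
  | ind i ih =>
    have hi : i ∈ S := h i le_rfl rfl
    rcases lt_trichotomy (p i) i with hlt | heq | hgt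
    · have hpi : p i ∈ S := h _ hlt.le (hb i)
      have hpp := hm _ hpi _ hi hlt
      exact p.injective (ih (p i) hlt (fun j hj hbj => h j (hj.trans hlt.le) (hbj.trans (hb i)))
        fun j hj hbj => h' j (hj.trans hpp.le) (hbj.trans (hb i)))
    · exact heq
    · obtain ⟨k, rfl⟩ := p.surjective i
      have hk : k ∈ S := by simpa using h' _ hgt.le rfl
      have hki : k < p k := by
        by_contra! hle
        rcases hle.lt_or_eq with hlt | heq
        · exact (hm _ hi _ hk hlt).asymm hgt
        · rw [heq, heq] at hgt
          exact hgt.ne rfl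
      have := ih k hki (fun j hj hbj => h j (hj.trans hki.le) (hbj.trans (hb k).symm))
        fun j hj hbj => h' j (hj.trans hgt.le) (hbj.trans (hb k).symm)
      exact absurd this hki.ne'

theorem eq_of_forall_not_fixed {p : Perm (Fin n)} (hc : ∀ i, τ (p i) = p (σ i))
    (hp : ∀ i, σ i ≠ i → p i = i) : σ = τ := by
  ext1 x
  by_cases hx : σ x = x
  · obtain ⟨y, rfl⟩ := p.surjective x
    by_cases hy : σ y = y
    · rw [hx, hc, hy]
    · rw [hp y hy] at hx
      exact absurd hx hy
  · have := hc x
    rw [hp x hx, hp _ (σ.injective.ne hx)] at this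
    exact this.symm

theorem apply_eq_of_not_fixed_above {p : Perm (Fin n)} (hc : ∀ i, τ (p i) = p (σ i))
    (hb : ∀ i, b (p i) = b i) (hm : ∀ i j, σ i ≠ i → σ j ≠ j → i < j → p i < p j) (i : Fin n)
    (h : ∀ j, i ≤ j → b j = b i → σ j ≠ j) (h' : ∀ j, p i ≤ j → b j = b (p i) → τ j ≠ j) :
    p i = i :=
  apply_eq_of_initial_segment (α := (Fin n)ᵒᵈ) (b := b) (S := {i | σ i ≠ i}) (p := p) hb
    (fun i hi j hj hij => hm j i hj hi hij) i h fun j hj hbj => by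
      have := h' j hj (hbj.trans (hb i).symm)
      obtain ⟨k, rfl⟩ := p.surjective j
      rw [hc, p.injective.ne_iff] at this
      change σ (p.symm (p k)) ≠ p.symm (p k)
      rwa [symm_apply_apply]

theorem apply_eq_of_not_fixed_below {p : Perm (Fin n)} (hc : ∀ i, τ (p i) = p (σ i))
    (hb : ∀ i, b (p i) = b i) (hm : ∀ i j, σ i ≠ i → σ j ≠ j → i < j → p i < p j) (i : Fin n)
    (h : ∀ j, j ≤ i → b j = b i → σ j ≠ j) (h' : ∀ j, j ≤ p i → b j = b (p i) → τ j ≠ j) :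
    p i = i :=
  apply_eq_of_initial_segment (S := {i | σ i ≠ i}) hb
    (fun i hi j hj hij => hm i j hi hj hij) i h fun j hj hbj => by
      have := h' j hj (hbj.trans (hb i).symm)
      obtain ⟨k, rfl⟩ := p.surjective j
      rw [hc, p.injective.ne_iff] at this
      simpa using this

theorem ZeroBlockAscending.ne_of_le (hb : Monotone b) (h : ZeroBlockAscending b σ) {i j : Fin n}
    (hi : σ i ≠ i) (hij : i ≤ j) (hbij : b j = b i) : σ j ≠ j := by
  rcases hij.lt_or_eq with hlt | rfl
  · exact ((h.fixed_or_lt hb hlt hbij.symm).resolve_left hi).1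
  · exact hi

theorem ZeroBlockAscending.eq_of_fixShift (hb : Monotone b) (hσ : ZeroBlockAscending b σ)
    (hτ : ZeroBlockAscending b τ) (h : FixShift b σ τ) : σ = τ := by
  obtain ⟨p, hc, hp, hm⟩ := h
  refine eq_of_forall_not_fixed hc fun i hi => apply_eq_of_not_fixed_above hc hp hm i
    (fun j => hσ.ne_of_le hb hi) fun j => hτ.ne_of_le hb ?_
  rwa [hc, p.injective.ne_iff]

theorem BlockAscending.ne_of_ge (hb : Monotone b) (h : BlockAscending b σ) {i j : Fin n}
    (hi : σ i < i) (hij : j ≤ i) (hbij : b j = b i) : σ j ≠ j := by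
  rcases hij.lt_or_eq with hlt | rfl
  · have := h.add_le hb hlt hbij
    simp only [Fin.lt_def, ne_eq, Fin.ext_iff] at *
    omega
  · exact hi.ne

theorem BlockAscending.ne_of_le (hb : Monotone b) (h : BlockAscending b σ) {i j : Fin n}
    (hi : i < σ i) (hij : i ≤ j) (hbij : b j = b i) : σ j ≠ j := by
  rcases hij.lt_or_eq with hlt | rfl
  · have := h.add_le hb hlt hbij.symm
    simp only [Fin.lt_def, ne_eq, Fin.ext_iff] at *
    omega
  · exact hi.ne'

theorem BlockAscending.eq_of_fixShift (hb : Monotone b) (hσ : BlockAscending b σ)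
    (hτ : BlockAscending b τ) (h : FixShift b σ τ) : σ = τ := by
  obtain ⟨p, hc, hp, hm⟩ := h
  refine eq_of_forall_not_fixed hc fun i hi => ?_
  rcases lt_or_gt_of_ne hi with hlt | hgt
  · refine apply_eq_of_not_fixed_below hc hp hm i (fun j => hσ.ne_of_ge hb hlt)
      fun j => hτ.ne_of_ge hb ?_
    rw [hc]
    exact hm _ _ (σ.injective.ne hi) hi hlt
  · refine apply_eq_of_not_fixed_above hc hp hm i (fun j => hσ.ne_of_le hb hgt)
      fun j => hτ.ne_of_le hb ?_
    rw [hc]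
    exact (lt_apply_iff_of_fixShift hm i).mpr hgt

end Rearrangement

/-- The index of the block containing a position, when `[n]` is cut after each element of `D`
(positions being `0`-based, `i` is the `i + 1`st letter). -/
def blockIndex {n : ℕ} (D : Finset ℕ) (i : Fin n) : ℕ := #{d ∈ D | d ≤ (i : ℕ)}

theorem blockIndex_monotone {n : ℕ} (D : Finset ℕ) : Monotone (blockIndex D (n := n)) :=
  fun _ _ hij => card_le_card (monotone_filter_right _ fun _ _ h => le_trans h hij)

theorem blockIndex_eq_iff {n : ℕ} (D : Finset ℕ) {i j : Fin n} (hij : (j : ℕ) = i + 1) :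
    blockIndex D i = blockIndex D j ↔ (j : ℕ) ∉ D := by
  have hsub : {d ∈ D | d ≤ (i : ℕ)} ⊆ {d ∈ D | d ≤ (j : ℕ)} :=
    monotone_filter_right _ fun _ _ h => by omega
  constructor
  · intro h hj
    have heq := eq_of_subset_of_card_le hsub h.ge
    have : (j : ℕ) ∈ {d ∈ D | d ≤ (i : ℕ)} := heq ▸ by simp [hj]
    simp only [mem_filter] at this
    omega
  · intro hj
    refine congrArg card (filter_congr fun d hd => ?_)
    have : d ≠ j := fun h => hj (h ▸ hd)
    omega

theorem zeroWord_succ {n : ℕ} (σ : Perm (Fin n)) (i : Fin n) :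
    zeroWord σ (i + 1) = if σ i = i then 0 else (σ i : ℕ) + 1 := by
  simp [zeroWord, permToFun_succ, Fin.ext_iff]

theorem filter_subset_iff_adjacent {n : ℕ} (w : ℕ → ℕ) (D : Finset ℕ) :
    {i ∈ Icc 1 (n - 1) | w (i + 1) < w i} ⊆ D ↔
      ∀ i j : Fin n, (j : ℕ) = i + 1 → blockIndex D i = blockIndex D j →
        w (i + 1) ≤ w (j + 1) := by
  constructor
  · intro h i j hij hb
    rw [blockIndex_eq_iff D hij] at hb
    by_contra! hlt
    refine hb (h ?_)
    have := j.2
    rw [mem_filter, mem_Icc]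
    refine ⟨by omega, ?_⟩
    rwa [← hij] at hlt
  · intro h k hk
    rw [mem_filter, mem_Icc] at hk
    by_contra hkD
    have := h ⟨k - 1, by omega⟩ ⟨k, by omega⟩ (by simp; omega)
      ((blockIndex_eq_iff D (by simp; omega)).mpr hkD)
    simp only [Nat.sub_add_cancel hk.1.1] at this
    omega

theorem desSet_subset_iff {n : ℕ} (σ : Perm (Fin n)) (D : Finset ℕ) :
    desSet σ ⊆ D ↔ BlockAscending (blockIndex D) σ := by
  rw [desSet, filter_subset_iff_adjacent]
  refine forall₄_congr fun i j hij _ => ?_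
  have : (σ i : ℕ) ≠ σ j := fun h => by
    have := σ.injective (Fin.ext h)
    subst this
    omega
  rw [permToFun_succ, permToFun_succ, Fin.lt_def]
  omega

theorem dezSet_subset_iff {n : ℕ} (σ : Perm (Fin n)) (D : Finset ℕ) :
    dezSet σ ⊆ D ↔ ZeroBlockAscending (blockIndex D) σ := by
  rw [dezSet, filter_subset_iff_adjacent]
  refine forall₄_congr fun i j hij _ => ?_
  have : (σ i : ℕ) ≠ σ j := fun h => by
    have := σ.injective (Fin.ext h)
    subst this
    omega
  rw [zeroWord_succ, zeroWord_succ, Fin.lt_def]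
  split_ifs with hi hj hj <;> simp [hi, hj]
  omega

theorem card_desSet_subset_eq (n f e : ℕ) (D : Finset ℕ) :
    #{σ : Perm (Fin n) | (fixCount σ = f ∧ excCount σ = e) ∧ desSet σ ⊆ D} =
      #{σ : Perm (Fin n) | (fixCount σ = f ∧ excCount σ = e) ∧ dezSet σ ⊆ D} := by
  have hb := blockIndex_monotone (n := n) D
  apply le_antisymm
  · refine card_le_card_of_forall_subsingleton (FixShift (blockIndex D)) (fun σ hσ => ?_)
      fun τ _ σ hσ σ' hσ' => ?_
    · simp only [mem_filter, mem_univ, true_and, desSet_subset_iff, dezSet_subset_iff] at hσ ⊢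
      obtain ⟨τ, h, hτ⟩ := hσ.2.exists_fixShift hb
      exact ⟨τ, by simpa [h.fixCount_eq, h.excCount_eq, hτ] using hσ.1, h⟩
    · simp only [mem_filter, mem_univ, true_and, Set.mem_ofPred_eq, desSet_subset_iff] at hσ hσ'
      exact hσ.1.2.eq_of_fixShift hb hσ'.1.2 (hσ.2.trans hσ'.2.symm)
  · refine card_le_card_of_forall_subsingleton (FixShift (blockIndex D)) (fun σ hσ => ?_)
      fun τ _ σ hσ σ' hσ' => ?_
    · simp only [mem_filter, mem_univ, true_and, desSet_subset_iff, dezSet_subset_iff] at hσ ⊢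
      obtain ⟨τ, h, hτ⟩ := hσ.2.exists_fixShift hb
      exact ⟨τ, by simpa [h.fixCount_eq, h.excCount_eq, hτ] using hσ.1, h⟩
    · simp only [mem_filter, mem_univ, true_and, Set.mem_ofPred_eq, dezSet_subset_iff] at hσ hσ'
      exact hσ.1.2.eq_of_fixShift hb hσ'.1.2 (hσ.2.trans hσ'.2.symm)

/-- Two set-valued statistics are equidistributed as soon as they are contained in every given set
equally often. -/
theorem card_filter_eq_of_card_filter_subset {α ι : Type*} [DecidableEq ι] (s : Finset α)
    (X Y : α → Finset ι) (h : ∀ D, #{x ∈ s | X x ⊆ D} = #{x ∈ s | Y x ⊆ D}) (D : Finset ι) :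
    #{x ∈ s | X x = D} = #{x ∈ s | Y x = D} := by
  have key : ∀ (Z : α → Finset ι) (D : Finset ι), #{x ∈ s | Z x ⊆ D} =
      #{x ∈ s | Z x = D} + ∑ E ∈ D.ssubsets, #{x ∈ s | Z x = E} := fun Z D => by
    rw [card_eq_sum_card_fiberwise (f := Z) (t := D.powerset) (fun x hx => by simp_all),
      ← add_sum_erase _ _ (mem_powerset_self D)]
    simp only [filter_filter]
    congr 1
    · exact congrArg card (filter_congr fun x _ => by grind)
    · refine sum_congr rfl fun E hE => congrArg card (filter_congr fun x _ => ?_)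
      rw [mem_ssubsets] at hE
      grind
  induction D using Finset.strongInduction with
  | H D ih =>
    have hD := h D
    rw [key, key, sum_congr rfl fun E hE => ih E (mem_ssubsets.mp hE)] at hD
    exact Nat.add_right_cancel hD

/-- There is a bijection `Φ` of `S_n` onto itself such that
`fix Φ(π) = fix π`, `exc Φ(π) = exc π` and `DEZ Φ(π) = DES π` for all `π`; in
particular `(fix, exc, DEZ)` and `(fix, exc, DES)` are equidistributed on `S_n`. -/
theorem exists_bijection_DEZ_DES (n : ℕ) (hn : 0 < n) :
    ∃ Φ : Equiv.Perm (Fin n) ≃ Equiv.Perm (Fin n),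
      ∀ π : Equiv.Perm (Fin n),
        fixCount (Φ π) = fixCount π ∧ excCount (Φ π) = excCount π ∧
          dezSet (Φ π) = desSet π := by
  let stat (D : Perm (Fin n) → Finset ℕ) (σ : Perm (Fin n)) := ((fixCount σ, excCount σ), D σ)
  have hcard : ∀ c, Nonempty ({σ // stat desSet σ = c} ≃ {σ // stat dezSet σ = c}) := by
    rintro ⟨⟨f, e⟩, D⟩
    refine Fintype.card_eq.mp ?_
    rw [Fintype.card_subtype, Fintype.card_subtype]
    have := card_filter_eq_of_card_filter_subset
      {σ : Perm (Fin n) | fixCount σ = f ∧ excCount σ = e} desSet dezSet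
      (fun D => by simpa only [filter_filter] using card_desSet_subset_eq n f e D) D
    simpa only [stat, Prod.mk.injEq, filter_filter] using this
  let Φ := Equiv.ofFiberEquiv fun c => (hcard c).some
  refine ⟨Φ, fun π => ?_⟩
  have h : stat dezSet (Φ π) = stat desSet π := Equiv.ofFiberEquiv_map _ π
  simp only [stat, Prod.mk.injEq] at h
  exact ⟨h.1.1, h.1.2, h.2⟩
end

section
/- For every positive integer n and every nonnegative integer k, the number of alternating permutations of [2n] with exactly n fixed points and exactly k excedances equals the number of derangements of [n] with exactly k excedances. -/
/-- Alternating permutation: `π₁ > π₂ < π₃ > ⋯`, i.e. `DES π = {1,3,5,…} ∩ [n-1]`. -/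
def IsAlternating {n : ℕ} (σ : Equiv.Perm (Fin n)) : Prop :=
  desSet σ = (Finset.Icc 1 (n - 1)).filter fun i => Odd i

/-- Reverse alternating permutation: `π₁ < π₂ > π₃ < ⋯`, i.e. `DES π = {2,4,6,…} ∩ [n-1]`. -/
def IsRevAlternating {n : ℕ} (σ : Equiv.Perm (Fin n)) : Prop :=
  desSet σ = (Finset.Icc 1 (n - 1)).filter fun i => Even i

theorem permToFun_val_add_one {n : ℕ} (σ : Equiv.Perm (Fin n)) (x : Fin n) :
    permToFun σ (x.val + 1) = (σ x).val + 1 := by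
  have h : 1 ≤ x.val + 1 ∧ x.val + 1 ≤ n := ⟨by omega, x.isLt⟩
  simp [permToFun, h]

theorem card_filter_Icc_one (n : ℕ) (p : ℕ → Prop) [DecidablePred p] :
    ((Finset.Icc 1 n).filter p).card
      = (Finset.univ.filter fun x : Fin n => p (x.val + 1)).card := by
  symm
  refine Finset.card_bij (fun x _ => x.val + 1) ?_ ?_ ?_
  · intro x hx
    simp only [Finset.mem_filter, Finset.mem_univ, true_and, Finset.mem_Icc] at hx ⊢
    exact ⟨⟨by omega, x.isLt⟩, hx⟩
  · intro x _ y _ h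
    exact Fin.ext (by omega)
  · intro b hb
    simp only [Finset.mem_filter, Finset.mem_Icc] at hb
    have hb' : b - 1 + 1 = b := by omega
    exact ⟨⟨b - 1, by omega⟩, by simpa [hb'] using hb.2, hb'⟩

theorem fixCount_eq_card_filter {n : ℕ} (σ : Equiv.Perm (Fin n)) :
    fixCount σ = (Finset.univ.filter fun x => σ x = x).card := by
  rw [fixCount, card_filter_Icc_one]
  simp [permToFun_val_add_one, Fin.ext_iff]

theorem excCount_eq_card_filter {n : ℕ} (σ : Equiv.Perm (Fin n)) :
    excCount σ = (Finset.univ.filter fun x => x < σ x).card := by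
  rw [excCount, card_filter_Icc_one]
  simp [permToFun_val_add_one]

theorem fixCount_eq_zero_iff {n : ℕ} (σ : Equiv.Perm (Fin n)) :
    fixCount σ = 0 ↔ ∀ x, σ x ≠ x := by
  simp [fixCount_eq_card_filter, Finset.filter_eq_empty_iff]

theorem isAlternating_iff {n : ℕ} (σ : Equiv.Perm (Fin n)) :
    IsAlternating σ ↔ ∀ x y : Fin n, y.val = x.val + 1 → (σ y < σ x ↔ Even x.val) := by
  rw [IsAlternating, desSet, Finset.filter_inj']
  constructor
  · intro h x y hxy
    have hy := y.isLt
    have := @h (x.val + 1) (Finset.mem_Icc.2 ⟨by omega, by omega⟩)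
    rw [← hxy, permToFun_val_add_one, hxy, permToFun_val_add_one, Nat.odd_add_one,
      Nat.not_odd_iff_even] at this
    rw [Fin.lt_def, ← this]
    omega
  · intro h i hi
    rw [Finset.mem_Icc] at hi
    obtain ⟨j, rfl⟩ : ∃ j, i = j + 1 := ⟨i - 1, by omega⟩
    have := h ⟨j, by omega⟩ ⟨j + 1, by omega⟩ rfl
    have h₁ := permToFun_val_add_one σ ⟨j, by omega⟩
    have h₂ := permToFun_val_add_one σ ⟨j + 1, by omega⟩
    simp only at h₁ h₂ this
    rw [h₁, h₂, Nat.odd_add_one, Nat.not_odd_iff_even, ← this, Fin.lt_def]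
    omega

/-- The embedding of `Fin n` into `Fin (2 * n)` that selects the first element of the `i`-th
block `{2i, 2i + 1}` unless `σ i < i`, in which case it selects the second. -/
def blockEmb {n : ℕ} (σ : Equiv.Perm (Fin n)) : Fin n ↪ Fin (2 * n) where
  toFun i := ⟨if σ i < i then 2 * i.val + 1 else 2 * i.val, by split_ifs <;> omega⟩
  inj' i j h := by
    simp only [Fin.mk.injEq] at h
    apply Fin.ext
    split_ifs at h <;> omega

theorem blockEmb_val {n : ℕ} (σ : Equiv.Perm (Fin n)) (i : Fin n) :
    (blockEmb σ i).val = if σ i < i then 2 * i.val + 1 else 2 * i.val := rfl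

theorem blockEmb_div {n : ℕ} (σ : Equiv.Perm (Fin n)) (i : Fin n) :
    (blockEmb σ i).val / 2 = i.val := by
  rw [blockEmb_val]; split_ifs <;> omega

theorem blockEmb_lt_iff {n : ℕ} (σ : Equiv.Perm (Fin n)) (i j : Fin n) :
    blockEmb σ i < blockEmb σ j ↔ i < j := by
  rw [Fin.lt_def, Fin.lt_def, blockEmb_val, blockEmb_val]
  rcases eq_or_ne i j with rfl | h
  · simp
  · have := Fin.val_ne_of_ne h
    split_ifs <;> omega

/-- The permutation of `Fin (2 * n)` acting as `σ` on the range of `blockEmb σ` and fixing every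
other point. -/
def doublePerm {n : ℕ} (σ : Equiv.Perm (Fin n)) : Equiv.Perm (Fin (2 * n)) :=
  σ.viaFintypeEmbedding (blockEmb σ)

theorem doublePerm_blockEmb {n : ℕ} (σ : Equiv.Perm (Fin n)) (i : Fin n) :
    doublePerm σ (blockEmb σ i) = blockEmb σ (σ i) :=
  Equiv.Perm.viaFintypeEmbedding_apply_image _ _ _

theorem doublePerm_of_notMem {n : ℕ} (σ : Equiv.Perm (Fin n)) {x : Fin (2 * n)}
    (hx : x ∉ Set.range (blockEmb σ)) : doublePerm σ x = x :=
  Equiv.Perm.viaFintypeEmbedding_apply_notMem_range _ _ hx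

theorem doublePerm_eq_self_iff {n : ℕ} {σ : Equiv.Perm (Fin n)} (hσ : ∀ i, σ i ≠ i)
    (x : Fin (2 * n)) : doublePerm σ x = x ↔ x ∉ Set.range (blockEmb σ) := by
  refine ⟨?_, doublePerm_of_notMem σ⟩
  rintro h ⟨i, rfl⟩
  rw [doublePerm_blockEmb] at h
  exact hσ i ((blockEmb σ).injective h)

theorem fixCount_doublePerm {n : ℕ} {σ : Equiv.Perm (Fin n)} (hσ : ∀ i, σ i ≠ i) :
    fixCount (doublePerm σ) = n := by
  have h : (Finset.univ.filter fun x => doublePerm σ x = x)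
      = (Finset.univ.map (blockEmb σ))ᶜ := by
    ext x
    simp [doublePerm_eq_self_iff hσ]
  rw [fixCount_eq_card_filter, h, Finset.card_compl, Finset.card_map, Finset.card_univ,
    Fintype.card_fin, Fintype.card_fin]
  omega

theorem excCount_doublePerm {n : ℕ} (σ : Equiv.Perm (Fin n)) :
    excCount (doublePerm σ) = excCount σ := by
  have h : (Finset.univ.filter fun x => x < doublePerm σ x)
      = (Finset.univ.filter fun i => i < σ i).map (blockEmb σ) := by
    ext x
    simp only [Finset.mem_filter, Finset.mem_univ, true_and, Finset.mem_map]
    constructor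
    · intro hx
      by_cases hr : x ∈ Set.range (blockEmb σ)
      · obtain ⟨i, rfl⟩ := hr
        rw [doublePerm_blockEmb, blockEmb_lt_iff] at hx
        exact ⟨i, hx, rfl⟩
      · exact absurd hx (by simp [doublePerm_of_notMem σ hr])
    · rintro ⟨i, hi, rfl⟩
      rwa [doublePerm_blockEmb, blockEmb_lt_iff]
  rw [excCount_eq_card_filter, excCount_eq_card_filter, h, Finset.card_map]

/-- On each block, one element is fixed, and the other one is sent outside of the block, in the
direction given by the parity. -/
theorem doublePerm_val_cases {n : ℕ} {σ : Equiv.Perm (Fin n)} (hσ : ∀ i, σ i ≠ i)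
    (x : Fin (2 * n)) :
    doublePerm σ x = x ∨
      Even x.val ∧ x.val + 1 < (doublePerm σ x).val ∨
      Odd x.val ∧ (doublePerm σ x).val + 1 < x.val := by
  by_cases hr : x ∈ Set.range (blockEmb σ)
  · right
    obtain ⟨i, rfl⟩ := hr
    rw [doublePerm_blockEmb]
    have h₁ := blockEmb_div σ (σ i)
    have h₂ := Fin.val_ne_of_ne (hσ i)
    rw [blockEmb_val σ i, Nat.even_iff, Nat.odd_iff]
    split_ifs with h <;> rw [Fin.lt_def] at h <;> omega
  · exact Or.inl (doublePerm_of_notMem σ hr)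

theorem isAlternating_doublePerm {n : ℕ} {σ : Equiv.Perm (Fin n)} (hσ : ∀ i, σ i ≠ i) :
    IsAlternating (doublePerm σ) := by
  rw [isAlternating_iff]
  intro x y hxy
  have hx := doublePerm_val_cases hσ x
  have hy := doublePerm_val_cases hσ y
  rw [Fin.lt_def]
  simp only [Nat.even_iff, Nat.odd_iff, Fin.ext_iff] at hx hy ⊢
  by_cases hev : x.val % 2 = 0
  · have hmoved : doublePerm σ x ≠ x ∨ doublePerm σ y ≠ y := by
      have hi : x.val / 2 < n := by omega
      have hv := blockEmb_div σ ⟨x.val / 2, hi⟩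
      simp only at hv
      rw [Ne, Ne, doublePerm_eq_self_iff hσ, doublePerm_eq_self_iff hσ, not_not, not_not]
      rcases Nat.mod_two_eq_zero_or_one (blockEmb σ ⟨x.val / 2, hi⟩).val with h | h
      · exact Or.inl ⟨⟨x.val / 2, hi⟩, Fin.ext (by omega)⟩
      · exact Or.inr ⟨⟨x.val / 2, hi⟩, Fin.ext (by omega)⟩
    simp only [Ne, Fin.ext_iff] at hmoved
    omega
  · omega

theorem doublePerm_injOn {n : ℕ} {σ τ : Equiv.Perm (Fin n)} (hσ : ∀ i, σ i ≠ i)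
    (hτ : ∀ i, τ i ≠ i) (h : doublePerm σ = doublePerm τ) : σ = τ := by
  have he : ∀ i, blockEmb σ i = blockEmb τ i := by
    intro i
    have hm : blockEmb σ i ∈ Set.range (blockEmb τ) := by
      by_contra hc
      rw [← doublePerm_eq_self_iff hτ, ← h, doublePerm_eq_self_iff hσ] at hc
      exact hc ⟨i, rfl⟩
    obtain ⟨j, hj⟩ := hm
    have : j = i := Fin.ext (by rw [← blockEmb_div τ j, hj, blockEmb_div])
    rw [← hj, this]
  ext1 i
  apply (blockEmb σ).injective
  rw [← doublePerm_blockEmb, h, he, doublePerm_blockEmb, he]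

theorem exists_doublePerm_eq {n : ℕ} {π : Equiv.Perm (Fin (2 * n))} (hπ : IsAlternating π)
    (hfix : fixCount π = n) : ∃ σ : Equiv.Perm (Fin n), (∀ i, σ i ≠ i) ∧ doublePerm σ = π := by
  rw [isAlternating_iff] at hπ
  rw [fixCount_eq_card_filter] at hfix
  have desc : ∀ x y : Fin (2 * n), x.val / 2 = y.val / 2 → x.val < y.val → π y < π x := by
    intro x y h hlt
    exact (hπ x y (by omega)).2 (Nat.even_iff.2 (by omega))
  have fix_unique : ∀ x y : Fin (2 * n), x.val / 2 = y.val / 2 → π x = x → π y = y → x = y := by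
    intro x y h hx hy
    rcases lt_trichotomy x.val y.val with hlt | heq | hlt
    · have := desc x y h hlt
      rw [hx, hy, Fin.lt_def] at this
      omega
    · exact Fin.ext heq
    · have := desc y x h.symm hlt
      rw [hx, hy, Fin.lt_def] at this
      omega
  let block : Fin (2 * n) → Fin n := fun x => ⟨x.val / 2, by omega⟩
  have fix_exists : ∀ i : Fin n, ∃ x : Fin (2 * n), x.val / 2 = i.val ∧ π x = x := by
    have himg : (Finset.univ.filter fun x => π x = x).image block = Finset.univ := by
      apply Finset.eq_univ_of_card
      rw [Finset.card_image_of_injOn, hfix, Fintype.card_fin]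
      intro x hx y hy hxy
      simp only [Finset.mem_coe, Finset.mem_filter, Finset.mem_univ, true_and] at hx hy
      exact fix_unique x y (congrArg Fin.val hxy) hx hy
    intro i
    have hi : i ∈ (Finset.univ.filter fun x => π x = x).image block := himg ▸ Finset.mem_univ i
    obtain ⟨x, hx, hxi⟩ := Finset.mem_image.1 hi
    exact ⟨x, congrArg Fin.val hxi, (Finset.mem_filter.1 hx).2⟩
  have moved_unique : ∀ x y : Fin (2 * n), x.val / 2 = y.val / 2 → π x ≠ x → π y ≠ y → x = y := by
    intro x y h hx hy
    obtain ⟨z, hz, hzf⟩ := fix_exists (block x)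
    have hzx : z.val ≠ x.val := fun hc => hx (Fin.ext hc ▸ hzf)
    have hzy : z.val ≠ y.val := fun hc => hy (Fin.ext hc ▸ hzf)
    simp only [block] at hz
    exact Fin.ext (by omega)
  have moved_exists : ∀ i : Fin n, ∃ x : Fin (2 * n), x.val / 2 = i.val ∧ π x ≠ x := by
    intro i
    by_contra! hc
    have := fix_unique ⟨2 * i.val, by omega⟩ ⟨2 * i.val + 1, by omega⟩
      (by simp only; omega) (hc _ (by simp only; omega)) (hc _ (by simp only; omega))
    simp [Fin.ext_iff] at this
  choose m hm hmoved using moved_exists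
  have moved_apply : ∀ i, π (π (m i)) ≠ π (m i) := fun i h => hmoved i (π.injective h)
  have hinj : Function.Injective fun i => block (π (m i)) := by
    intro i j hij
    have := π.injective (moved_unique _ _ (congrArg Fin.val hij) (moved_apply i) (moved_apply j))
    exact Fin.ext (by rw [← hm i, this, hm])
  let σ : Equiv.Perm (Fin n) := Equiv.ofBijective _ (Finite.injective_iff_bijective.1 hinj)
  have hσ : ∀ i, (σ i).val = (π (m i)).val / 2 := fun i => rfl
  have dir : ∀ i, (m i).val = 2 * i.val ∧ i < σ i ∨ (m i).val = 2 * i.val + 1 ∧ σ i < i := by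
    intro i
    obtain ⟨z, hz, hzf⟩ := fix_exists i
    have hzm : z.val ≠ (m i).val := fun hc => hmoved i (Fin.ext hc ▸ hzf)
    have hmi := hm i
    simp only [Fin.lt_def, hσ]
    rcases Nat.lt_or_gt_of_ne hzm with hlt | hlt
    · have := desc z (m i) (by omega) hlt
      rw [hzf, Fin.lt_def] at this
      omega
    · have := desc (m i) z (by omega) hlt
      rw [hzf, Fin.lt_def] at this
      omega
  have hemb : ∀ i, blockEmb σ i = m i := by
    intro i
    apply Fin.ext
    rw [blockEmb_val]
    rcases dir i with ⟨h₁, h₂⟩ | ⟨h₁, h₂⟩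
    · rw [if_neg h₂.not_gt, h₁]
    · rw [if_pos h₂, h₁]
  refine ⟨σ, fun i => ?_, ?_⟩
  · rcases dir i with ⟨_, h⟩ | ⟨_, h⟩
    exacts [h.ne', h.ne]
  · ext1 x
    by_cases hr : x ∈ Set.range (blockEmb σ)
    · obtain ⟨i, rfl⟩ := hr
      rw [doublePerm_blockEmb, hemb, hemb]
      exact moved_unique _ _ (by rw [hm, hσ]) (hmoved _) (moved_apply i)
    · rw [doublePerm_of_notMem σ hr]
      by_contra hc
      refine hr ⟨block x, ?_⟩
      rw [hemb]
      exact moved_unique _ _ (hm _) (hmoved _) (Ne.symm hc)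

/-- The number of alternating permutations of `[2n]` with exactly `n`
fixed points and exactly `k` excedances equals the number of derangements of `[n]`
with exactly `k` excedances. -/
theorem card_alternating_maxFix_exc (n : ℕ) (hn : 0 < n) (k : ℕ) :
    Nat.card {σ : Equiv.Perm (Fin (2 * n)) //
        IsAlternating σ ∧ fixCount σ = n ∧ excCount σ = k}
      = Nat.card {σ : Equiv.Perm (Fin n) // fixCount σ = 0 ∧ excCount σ = k} := by
  symm
  refine Nat.card_eq_of_bijective (fun σ => ⟨doublePerm σ.1, ?_, ?_, ?_⟩) ⟨?_, ?_⟩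
  · exact isAlternating_doublePerm ((fixCount_eq_zero_iff _).1 σ.2.1)
  · exact fixCount_doublePerm ((fixCount_eq_zero_iff _).1 σ.2.1)
  · exact (excCount_doublePerm _).trans σ.2.2
  · intro σ τ h
    exact Subtype.ext (doublePerm_injOn ((fixCount_eq_zero_iff _).1 σ.2.1)
      ((fixCount_eq_zero_iff _).1 τ.2.1) (congrArg Subtype.val h))
  · rintro ⟨π, hπ, hfix, hexc⟩
    obtain ⟨σ, hσ, rfl⟩ := exists_doublePerm_eq hπ hfix
    exact ⟨⟨σ, (fixCount_eq_zero_iff σ).2 hσ, (excCount_doublePerm σ).symm.trans hexc⟩, rfl⟩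
end

section
/- Every alternating permutation π of [n] has at most ⌈n/2⌉ fixed points. Moreover, if fix π = ⌈n/2⌉, then for every integer i with 1 ≤ i ≤ ⌈n/2⌉ exactly one element of {2i−1, 2i} ∩ [n] is a fixed point of π. -/
open Finset in
/-- In an alternating permutation, `2i-1` and `2i` are not both fixed points. -/
theorem IsAlternating.card_fixed_pair_le_one {n : ℕ} {π : Equiv.Perm (Fin n)}
    (hπ : IsAlternating π) {i : ℕ} (hi : 1 ≤ i) :
    ((({2 * i - 1, 2 * i} : Finset ℕ) ∩ Icc 1 n).filter fun j => permToFun π j = j).card ≤ 1 := by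
  have not_both (h : 2 * i ≤ n) (h1 : permToFun π (2 * i - 1) = 2 * i - 1)
      (h2 : permToFun π (2 * i) = 2 * i) : False := by
    have hmem : 2 * i - 1 ∈ desSet π := by
      rw [hπ, mem_filter, mem_Icc]
      exact ⟨by omega, i - 1, by omega⟩
    have hlt := (mem_filter.1 hmem).2
    rw [Nat.sub_add_cancel (by omega), h1, h2] at hlt
    omega
  rw [card_le_one]
  intro a ha b hb
  simp only [mem_filter, mem_inter, mem_insert, mem_singleton, mem_Icc] at ha hb
  obtain ⟨⟨rfl | rfl, ha1⟩, ha2⟩ := ha <;> obtain ⟨⟨rfl | rfl, hb1⟩, hb2⟩ := hb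
  · rfl
  · exact (not_both hb1.2 ha2 hb2).elim
  · exact (not_both ha1.2 hb2 ha2).elim
  · rfl

open Finset in
/-- The fixed points, counted along the blocks `{2i-1, 2i} ∩ [n]`. -/
theorem fixCount_eq_sum_card_fixed_pair {n : ℕ} (π : Equiv.Perm (Fin n)) :
    fixCount π = ∑ i ∈ Icc 1 ((n + 1) / 2),
      ((({2 * i - 1, 2 * i} : Finset ℕ) ∩ Icc 1 n).filter fun j => permToFun π j = j).card := by
  rw [fixCount, card_eq_sum_card_fiberwise (f := fun j => (j + 1) / 2)
    (t := Icc 1 ((n + 1) / 2))]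
  · refine sum_congr rfl fun i hi => congrArg card ?_
    ext j
    simp only [mem_filter, mem_inter, mem_insert, mem_singleton, mem_Icc] at hi ⊢
    constructor
    · rintro ⟨⟨hj, hf⟩, hji⟩
      exact ⟨⟨by omega, hj⟩, hf⟩
    · rintro ⟨⟨hji, hj⟩, hf⟩
      exact ⟨⟨hj, hf⟩, by omega⟩
  · intro j hj
    simp only [coe_filter, Set.mem_ofPred_eq, mem_Icc, coe_Icc, Set.mem_Icc] at hj ⊢
    omega

/-- An alternating permutation of `[n]` has at most `⌈n/2⌉` fixed
points; if it has exactly `⌈n/2⌉` fixed points, then for every `1 ≤ i ≤ ⌈n/2⌉` exactly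
one element of `{2i-1, 2i} ∩ [n]` is a fixed point. -/
theorem alternating_fix_le_ceil (n : ℕ) (hn : 0 < n) (π : Equiv.Perm (Fin n))
    (hπ : IsAlternating π) :
    fixCount π ≤ (n + 1) / 2 ∧
      (fixCount π = (n + 1) / 2 →
        ∀ i : ℕ, 1 ≤ i → i ≤ (n + 1) / 2 →
          ((({2 * i - 1, 2 * i} : Finset ℕ) ∩ Finset.Icc 1 n).filter
              fun j => permToFun π j = j).card = 1) := by
  have hle : ∀ i ∈ Finset.Icc 1 ((n + 1) / 2),
      ((({2 * i - 1, 2 * i} : Finset ℕ) ∩ Finset.Icc 1 n).filter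
        fun j => permToFun π j = j).card ≤ 1 :=
    fun i hi => hπ.card_fixed_pair_le_one (Finset.mem_Icc.1 hi).1
  have hcard : ∑ _i ∈ Finset.Icc 1 ((n + 1) / 2), 1 = (n + 1) / 2 := by simp
  rw [fixCount_eq_sum_card_fixed_pair π]
  refine ⟨(Finset.sum_le_sum hle).trans_eq hcard, fun heq i h1 h2 => ?_⟩
  exact (Finset.sum_eq_sum_iff_of_le hle).1 (heq.trans hcard.symm) i (Finset.mem_Icc.2 ⟨h1, h2⟩)
end

section
/- Let a and b be positive integers and let M(a,b) be the number of derangements π of [a+b] such that π(j) > π(j+1) for every j ∈ [a+b−1] with j ≠ a. Then M(a,b) = Σ_{j=2}^{a+b} Σ_{i=0}^{j} (−1)^j · C(a+b−j, a−i), where C(m, r) denotes the binomial coefficient, with the convention C(m, r) = 0 when r < 0 or r > m. -/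
namespace Equiv.Perm

variable {n : ℕ}

/-- `σ` is decreasing on the positions `l, …, r - 1` (counted from `0`). -/
def IsDec (σ : Equiv.Perm (Fin n)) (l r : ℕ) : Prop :=
  ∀ i j : Fin n, l ≤ (i : ℕ) → i < j → (j : ℕ) < r → σ j < σ i

/-- `σ` has no fixed point among the positions `l, …, r - 1` (counted from `0`). -/
def NoFix (σ : Equiv.Perm (Fin n)) (l r : ℕ) : Prop :=
  ∀ i : Fin n, l ≤ (i : ℕ) → (i : ℕ) < r → σ i ≠ i

/-- The permutation with fixed point `p` whose restriction to the other points is order-isomorphic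
to `σ`. -/
def insertFixed (p : Fin (n + 1)) (σ : Equiv.Perm (Fin n)) : Equiv.Perm (Fin (n + 1)) :=
  (finSuccEquiv' p).trans ((Equiv.optionCongr σ).trans (finSuccEquiv' p).symm)

@[simp]
theorem insertFixed_self (p : Fin (n + 1)) (σ : Equiv.Perm (Fin n)) : insertFixed p σ p = p := by
  simp [insertFixed]

@[simp]
theorem insertFixed_succAbove (p : Fin (n + 1)) (σ : Equiv.Perm (Fin n)) (i : Fin n) :
    insertFixed p σ (p.succAbove i) = p.succAbove (σ i) := by
  simp [insertFixed]

theorem insertFixed_injective (p : Fin (n + 1)) : Function.Injective (insertFixed p) := by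
  intro σ τ h
  refine Equiv.ext fun i => ?_
  have := congrArg (fun f => f (p.succAbove i)) h
  simpa using this

theorem exists_insertFixed_eq {p : Fin (n + 1)} {τ : Equiv.Perm (Fin (n + 1))} (h : τ p = p) :
    ∃ σ, insertFixed p σ = τ := by
  let e := finSuccEquiv' p
  let ρ : Equiv.Perm (Option (Fin n)) := (e.symm.trans τ).trans e
  have hρ : ρ none = none := by simp [ρ, e, h]
  have hopt := map_equiv_removeNone ρ
  rw [hρ, Equiv.swap_self] at hopt
  refine ⟨removeNone ρ, Equiv.ext fun x => ?_⟩
  have := congrArg (fun f => e.symm (f (e x))) hopt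
  simpa [insertFixed, ρ, e] using this

theorem val_succAbove (p : Fin (n + 1)) (i : Fin n) :
    ((p.succAbove i : Fin (n + 1)) : ℕ) = if (i : ℕ) < p then (i : ℕ) else i + 1 := by
  unfold Fin.succAbove
  simp only [Fin.lt_def, Fin.val_castSucc]
  split_ifs <;> simp

theorem isDec_insertFixed_of_le {p : Fin (n + 1)} {σ : Equiv.Perm (Fin n)} {l r : ℕ}
    (hp : r ≤ p) : (insertFixed p σ).IsDec l r ↔ σ.IsDec l r := by
  simp only [IsDec, Fin.forall_iff_succAbove p, insertFixed_self, insertFixed_succAbove,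
    Fin.succAbove_lt_succAbove_iff, val_succAbove]
  simp only [Fin.lt_def, val_succAbove]
  constructor
  · intro h i j hi hij hj
    refine (h.2 i).2 j ?_ hij ?_ <;> split_ifs <;> omega
  · intro h
    refine ⟨⟨?_, ?_⟩, fun i => ⟨?_, ?_⟩⟩
    · omega
    · intro j _ _ hj
      split_ifs at * <;> omega
    · omega
    · intro j hi hij hj
      refine h i j ?_ hij ?_ <;> split_ifs at * <;> omega

theorem isDec_insertFixed_of_ge {p : Fin (n + 1)} {σ : Equiv.Perm (Fin n)} {l r : ℕ}
    (hp : (p : ℕ) ≤ l) : (insertFixed p σ).IsDec (l + 1) (r + 1) ↔ σ.IsDec l r := by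
  simp only [IsDec, Fin.forall_iff_succAbove p, insertFixed_self, insertFixed_succAbove,
    Fin.succAbove_lt_succAbove_iff, val_succAbove]
  simp only [Fin.lt_def, val_succAbove]
  constructor
  · intro h i j hi hij hj
    refine (h.2 i).2 j ?_ hij ?_ <;> split_ifs <;> omega
  · intro h
    refine ⟨⟨?_, ?_⟩, fun i => ⟨?_, ?_⟩⟩
    · omega
    · omega
    · intro _ _ _
      split_ifs at * <;> omega
    · intro j hi hij hj
      refine h i j ?_ hij ?_ <;> split_ifs at * <;> omega

theorem noFix_insertFixed_of_le {p : Fin (n + 1)} {σ : Equiv.Perm (Fin n)} {l r : ℕ}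
    (hp : r ≤ p) : (insertFixed p σ).NoFix l r ↔ σ.NoFix l r := by
  simp only [NoFix, Fin.forall_iff_succAbove p, insertFixed_self, insertFixed_succAbove,
    val_succAbove, ne_eq, Fin.succAbove_right_inj]
  constructor
  · intro h i hi hr
    refine h.2 i ?_ ?_ <;> split_ifs <;> omega
  · intro h
    refine ⟨by omega, fun i hi hr => h i ?_ ?_⟩ <;> split_ifs at * <;> omega

/-- `p` separates the excedances of `σ` at the positions `l, …, r - 1` from the other positions
in such a way that inserting the fixed point `p` leaves `σ` decreasing there. -/
def IsCut (σ : Equiv.Perm (Fin n)) (l r p : ℕ) : Prop :=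
  ∀ i : Fin n, (l ≤ (i : ℕ) → (i : ℕ) < p → p ≤ σ i) ∧ (p ≤ (i : ℕ) → (i : ℕ) < r → (σ i : ℕ) < p)

theorem IsCut.noFix {σ : Equiv.Perm (Fin n)} {l r p : ℕ} (h : σ.IsCut l r p) : σ.NoFix l r := by
  intro i hl hr heq
  have := h i
  rw [heq] at this
  omega

theorem IsCut.eq {σ : Equiv.Perm (Fin n)} {l r p q : ℕ} (hr : r ≤ n) (hp : σ.IsCut l r p)
    (hq : σ.IsCut l r q) (hlp : l ≤ p) (hpr : p ≤ r) (hlq : l ≤ q) (hqr : q ≤ r) : p = q := by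
  rcases lt_trichotomy p q with h | h | h
  · have h1 := hp ⟨p, by omega⟩
    have h2 := hq ⟨p, by omega⟩
    simp only at h1 h2
    omega
  · exact h
  · have h1 := hp ⟨q, by omega⟩
    have h2 := hq ⟨q, by omega⟩
    simp only at h1 h2
    omega

theorem isDec_insertFixed_iff {p : Fin (n + 1)} {σ : Equiv.Perm (Fin n)} {l r : ℕ}
    (hl : l ≤ p) (hr : (p : ℕ) ≤ r) :
    (insertFixed p σ).IsDec l (r + 1) ↔ σ.IsDec l r ∧ σ.IsCut l r p := by
  simp only [IsDec, IsCut, Fin.forall_iff_succAbove p, insertFixed_self, insertFixed_succAbove,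
    Fin.succAbove_lt_succAbove_iff, val_succAbove]
  simp only [Fin.lt_def, val_succAbove]
  constructor
  · rintro ⟨⟨-, h1⟩, h2⟩
    refine ⟨fun i j hi hij hj => ?_, fun i => ⟨fun hi hip => ?_, fun hi hir => ?_⟩⟩
    · refine (h2 i).2 j ?_ hij ?_ <;> split_ifs <;> omega
    · have := (h2 i).1
      split_ifs at this <;> omega
    · have := h1 i
      split_ifs at this <;> omega
  · rintro ⟨hd, hc⟩
    refine ⟨⟨by omega, fun j => ?_⟩, fun i => ⟨?_, fun j hi hij hj => hd i j ?_ hij ?_⟩⟩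
    · have := hc j
      split_ifs <;> omega
    · have := hc i
      split_ifs <;> omega
    · split_ifs at hi <;> omega
    · split_ifs at hj <;> omega

theorem exists_isCut {σ : Equiv.Perm (Fin n)} {l r : ℕ} (hlr : l ≤ r) (hr : r ≤ n)
    (hd : σ.IsDec l r) (hf : σ.NoFix l r) : ∃ p, l ≤ p ∧ p ≤ r ∧ σ.IsCut l r p := by
  classical
  have hex : ∃ p, l ≤ p ∧ ∀ h : p < r, (σ ⟨p, by omega⟩ : ℕ) ≤ p := ⟨r, hlr, by omega⟩
  obtain ⟨hlp, hp⟩ := Nat.find_spec hex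
  have hmin := fun m => Nat.find_min hex (m := m)
  have hpr : Nat.find hex ≤ r := Nat.find_min' hex ⟨hlr, by omega⟩
  generalize Nat.find hex = p at *
  refine ⟨p, hlp, hpr, fun i => ⟨fun hi hip => ?_, fun hi hir => ?_⟩⟩
  · have h1 := hmin (p - 1) (by omega)
    push Not at h1
    obtain ⟨h2, h3⟩ := h1 (by omega)
    rcases eq_or_ne (i : ℕ) (p - 1) with h | h
    · have : i = ⟨p - 1, by omega⟩ := Fin.ext h
      rw [this]
      omega
    · have := hd i ⟨p - 1, by omega⟩ hi (Fin.lt_def.2 (by simp only; omega)) h2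
      rw [Fin.lt_def] at this
      omega
  · have h1 := hp (by omega)
    have h2 := hf ⟨p, by omega⟩ hlp (by simp only; omega)
    rw [ne_eq, Fin.ext_iff] at h2
    simp only at h2
    rcases eq_or_ne (i : ℕ) p with h | h
    · have : i = ⟨p, by omega⟩ := Fin.ext h
      rw [this]
      omega
    · have := hd ⟨p, by omega⟩ i hlp (Fin.lt_def.2 (by simp only; omega)) hir
      rw [Fin.lt_def] at this
      omega

open Classical in
/-- Deleting the fixed point from a decreasing block is a bijection onto the permutations which
have no fixed point in the shortened block. -/
theorem card_isDec_not_noFix {l r : ℕ} (hlr : l ≤ r) (hr : r ≤ n)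
    {P : Equiv.Perm (Fin n) → Prop} {Q : Equiv.Perm (Fin (n + 1)) → Prop}
    (hPQ : ∀ (p : Fin (n + 1)) σ, l ≤ (p : ℕ) → (p : ℕ) ≤ r → (Q (insertFixed p σ) ↔ P σ)) :
    (Finset.univ.filter fun σ : Equiv.Perm (Fin (n + 1)) =>
        σ.IsDec l (r + 1) ∧ ¬ σ.NoFix l (r + 1) ∧ Q σ).card =
      (Finset.univ.filter fun σ : Equiv.Perm (Fin n) =>
        σ.IsDec l r ∧ σ.NoFix l r ∧ P σ).card := by
  have hex : ∀ σ ∈ Finset.univ.filter fun σ : Equiv.Perm (Fin n) =>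
      σ.IsDec l r ∧ σ.NoFix l r ∧ P σ,
      ∃ p : Fin (n + 1), l ≤ (p : ℕ) ∧ (p : ℕ) ≤ r ∧ σ.IsCut l r p := by
    intro σ hσ
    obtain ⟨hd, hf, -⟩ := (Finset.mem_filter.1 hσ).2
    obtain ⟨p, h1, h2, h3⟩ := exists_isCut hlr hr hd hf
    exact ⟨⟨p, by omega⟩, h1, h2, h3⟩
  choose p hlp hpr hcut using hex
  symm
  refine Finset.card_bij (fun σ hσ => insertFixed (p σ hσ) σ) ?_ ?_ ?_
  · intro σ hσ
    obtain ⟨hd, hf, hP⟩ := (Finset.mem_filter.1 hσ).2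
    refine Finset.mem_filter.2 ⟨Finset.mem_univ _, ?_, ?_, ?_⟩
    · exact (isDec_insertFixed_iff (hlp σ hσ) (hpr σ hσ)).2 ⟨hd, hcut σ hσ⟩
    · intro h
      exact h (p σ hσ) (hlp σ hσ) (Nat.lt_succ_of_le (hpr σ hσ)) (insertFixed_self _ _)
    · exact (hPQ _ _ (hlp σ hσ) (hpr σ hσ)).2 hP
  · intro σ hσ τ hτ h
    have hpp : p σ hσ = p τ hτ := by
      by_contra hne
      obtain ⟨i, hi⟩ := Fin.exists_succAbove_eq hne
      have h1 : insertFixed (p τ hτ) τ (p σ hσ) = p σ hσ := by rw [← h, insertFixed_self]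
      rw [← hi, insertFixed_succAbove, Fin.succAbove_right_inj] at h1
      have h2 := val_succAbove (p τ hτ) i
      have := hlp σ hσ
      have := hpr σ hσ
      have := hlp τ hτ
      have := hpr τ hτ
      rw [hi] at h2
      refine (hcut τ hτ).noFix i ?_ ?_ h1 <;> split_ifs at h2 <;> omega
    rw [hpp] at h
    exact insertFixed_injective _ h
  · intro τ hτ
    obtain ⟨hd, hf, hQ⟩ := (Finset.mem_filter.1 hτ).2
    simp only [NoFix, not_forall, not_not] at hf
    obtain ⟨q, hlq, hqr, hq⟩ := hf
    obtain ⟨σ, rfl⟩ := exists_insertFixed_eq hq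
    have hqr' : (q : ℕ) ≤ r := Nat.lt_succ_iff.1 hqr
    obtain ⟨hd', hcut'⟩ := (isDec_insertFixed_iff hlq hqr').1 hd
    have hσ : σ ∈ Finset.univ.filter fun σ : Equiv.Perm (Fin n) =>
        σ.IsDec l r ∧ σ.NoFix l r ∧ P σ :=
      Finset.mem_filter.2 ⟨Finset.mem_univ _, hd', hcut'.noFix, (hPQ _ _ hlq hqr').1 hQ⟩
    refine ⟨σ, hσ, ?_⟩
    have : p σ hσ = q := Fin.ext <|
      (hcut σ hσ).eq hr hcut' (hlp σ hσ) (hpr σ hσ) hlq hqr'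
    rw [this]

open Classical in
theorem card_noFix_add_card_noFix {l r : ℕ} (hlr : l ≤ r) (hr : r ≤ n)
    {P : Equiv.Perm (Fin n) → Prop} {Q : Equiv.Perm (Fin (n + 1)) → Prop}
    (hPQ : ∀ (p : Fin (n + 1)) σ, l ≤ (p : ℕ) → (p : ℕ) ≤ r → (Q (insertFixed p σ) ↔ P σ)) :
    (Finset.univ.filter fun σ : Equiv.Perm (Fin (n + 1)) =>
        σ.IsDec l (r + 1) ∧ σ.NoFix l (r + 1) ∧ Q σ).card +
      (Finset.univ.filter fun σ : Equiv.Perm (Fin n) =>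
        σ.IsDec l r ∧ σ.NoFix l r ∧ P σ).card =
      (Finset.univ.filter fun σ : Equiv.Perm (Fin (n + 1)) => σ.IsDec l (r + 1) ∧ Q σ).card := by
  rw [← card_isDec_not_noFix hlr hr hPQ, ← Finset.card_filter_add_card_filter_not
    (s := Finset.univ.filter fun σ : Equiv.Perm (Fin (n + 1)) => σ.IsDec l (r + 1) ∧ Q σ)
    (fun σ => σ.NoFix l (r + 1)), Finset.filter_filter, Finset.filter_filter]
  congr 2 <;> ext σ <;> simp only [Finset.mem_filter] <;> tauto

open Classical in
theorem card_isDec_isDec (a b : ℕ) :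
    (Finset.univ.filter fun σ : Equiv.Perm (Fin (a + b)) =>
      σ.IsDec 0 a ∧ σ.IsDec a (a + b)).card = (a + b).choose a := by
  have hcompl : ∀ s ∈ Finset.powersetCard a (Finset.univ : Finset (Fin (a + b))),
      s.card = a ∧ sᶜ.card = b := by
    intro s hs
    have h := (Finset.mem_powersetCard.1 hs).2
    refine ⟨h, ?_⟩
    rw [Finset.card_compl, h, Fintype.card_fin]
    omega
  let f : ∀ s ∈ Finset.powersetCard a (Finset.univ : Finset (Fin (a + b))),
      Equiv.Perm (Fin (a + b)) := fun s hs =>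
    finSumFinEquiv.symm.trans ((Equiv.sumCongr Fin.revPerm Fin.revPerm).trans
      (finSumEquivOfFinset (hcompl s hs).1 (hcompl s hs).2))
  have hf₁ : ∀ s hs i, f s hs (Fin.castAdd b i) = s.orderEmbOfFin (hcompl s hs).1 i.rev := by
    intro s hs i
    simp [f]
  have hf₂ : ∀ s hs i, f s hs (Fin.natAdd a i) = sᶜ.orderEmbOfFin (hcompl s hs).2 i.rev := by
    intro s hs i
    simp [f]
  have hmem : ∀ s hs i, f s hs (Fin.castAdd b i) ∈ s := by
    intro s hs i
    rw [hf₁ s hs]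
    exact Finset.orderEmbOfFin_mem s (hcompl s hs).1 _
  have hcard : (Finset.powersetCard a (Finset.univ : Finset (Fin (a + b)))).card =
      (a + b).choose a := by simp
  rw [← hcard]
  symm
  refine Finset.card_bij f ?_ ?_ ?_
  · intro s hs
    refine Finset.mem_filter.2 ⟨Finset.mem_univ _, fun i j _ hij hj => ?_, fun i j hi hij _ => ?_⟩
    · induction i using Fin.addCases with
      | right i => rw [Fin.lt_def, Fin.val_natAdd] at hij; omega
      | left i =>
        induction j using Fin.addCases with
        | right j => rw [Fin.val_natAdd] at hj; omega
        | left j =>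
          rw [hf₁ s hs, hf₁ s hs, OrderEmbedding.lt_iff_lt, Fin.rev_lt_rev]
          exact hij
    · induction i using Fin.addCases with
      | left i => rw [Fin.val_castAdd] at hi; omega
      | right i =>
        induction j using Fin.addCases with
        | left j => rw [Fin.lt_def, Fin.val_castAdd, Fin.val_natAdd] at hij; omega
        | right j =>
          rw [hf₂ s hs, hf₂ s hs, OrderEmbedding.lt_iff_lt, Fin.rev_lt_rev, Fin.lt_def]
          rw [Fin.lt_def, Fin.val_natAdd, Fin.val_natAdd] at hij
          omega
  · intro s hs t ht h
    refine Finset.eq_of_subset_of_card_le (fun x hx => ?_) ?_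
    · have : x ∈ Set.range (s.orderEmbOfFin (hcompl s hs).1) := by
        rw [Finset.range_orderEmbOfFin]
        exact hx
      obtain ⟨i, rfl⟩ := this
      rw [← Fin.rev_rev i, ← hf₁ s hs, h]
      exact hmem t ht _
    · rw [(hcompl s hs).1, (hcompl t ht).1]
  · intro σ hσ
    obtain ⟨h₁, h₂⟩ := (Finset.mem_filter.1 hσ).2
    let s : Finset (Fin (a + b)) := Finset.univ.image fun i : Fin a => σ (Fin.castAdd b i)
    have hs : s ∈ Finset.powersetCard a (Finset.univ : Finset (Fin (a + b))) := by
      refine Finset.mem_powersetCard.2 ⟨Finset.subset_univ _, ?_⟩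
      refine (Finset.card_image_of_injective _
        (σ.injective.comp (Fin.castAdd_injective a b))).trans ?_
      rw [Finset.card_univ, Fintype.card_fin]
    refine ⟨s, hs, Equiv.ext fun i => ?_⟩
    induction i using Fin.addCases with
    | left i =>
      have := Finset.orderEmbOfFin_unique (hcompl s hs).1
        (f := fun i => σ (Fin.castAdd b i.rev))
        (fun i => Finset.mem_image.2 ⟨i.rev, Finset.mem_univ _, rfl⟩)
        (fun i j hij => h₁ _ _ (Nat.zero_le _) (Fin.rev_lt_rev.2 hij) i.rev.isLt)
      rw [hf₁ s hs, ← this]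
      simp only [Fin.rev_rev]
    | right i =>
      have := Finset.orderEmbOfFin_unique (hcompl s hs).2
        (f := fun i => σ (Fin.natAdd a i.rev))
        (fun i => by
          simp only [s, Finset.mem_compl, Finset.mem_image, not_exists, not_and]
          intro k _ h
          have := congrArg Fin.val (σ.injective h)
          rw [Fin.val_castAdd, Fin.val_natAdd] at this
          omega)
        (fun i j hij => h₂ _ _ (by simp)
          (by simpa [Fin.lt_def] using Fin.lt_def.1 (Fin.rev_lt_rev.2 hij)) (Fin.is_lt _))
      rw [hf₂ s hs, ← this]
      simp only [Fin.rev_rev]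

theorem isDec_of_le {σ : Equiv.Perm (Fin n)} {l r : ℕ} (h : r ≤ l) : σ.IsDec l r := by
  intro i j hi hij hj
  rw [Fin.lt_def] at hij
  omega

theorem noFix_of_le {σ : Equiv.Perm (Fin n)} {l r : ℕ} (h : r ≤ l) : σ.NoFix l r := by
  intro i hi hj
  omega

theorem noFix_append {σ : Equiv.Perm (Fin n)} {k l r : ℕ} (hkl : k ≤ l) (hlr : l ≤ r) :
    σ.NoFix k r ↔ σ.NoFix k l ∧ σ.NoFix l r := by
  refine ⟨fun h => ⟨fun i h1 h2 => h i h1 (by omega), fun i h1 h2 => h i (by omega) h2⟩,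
    fun h i h1 h2 => ?_⟩
  rcases lt_or_ge (i : ℕ) l with h3 | h3
  · exact h.1 i h1 h3
  · exact h.2 i h3 h2

theorem isDec_iff_succ {σ : Equiv.Perm (Fin n)} {l r : ℕ} :
    σ.IsDec l r ↔ ∀ i j : Fin n, l ≤ (i : ℕ) → (j : ℕ) = i + 1 → (j : ℕ) < r → σ j < σ i := by
  refine ⟨fun h i j hi hij hj => h i j hi (Fin.lt_def.2 (by omega)) hj, fun h i j hi hij hj => ?_⟩
  obtain ⟨j, hjn⟩ := j
  rw [Fin.lt_def] at hij
  simp only at hij hj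
  induction j, hij using Nat.le_induction with
  | base => exact h i _ hi rfl hj
  | succ m hm ih =>
    exact (h ⟨m, by omega⟩ ⟨m + 1, hjn⟩ (by simp only; omega) rfl hj).trans
      (ih (by omega) (by omega))

open Classical in
/-- The number of permutations of `Fin n` that are decreasing on the first `a` and on the last
`n - a` positions and have no fixed point among the first `a` positions. -/
noncomputable def firstBlockCount (n a : ℕ) : ℕ :=
  (Finset.univ.filter fun σ : Equiv.Perm (Fin n) =>
    σ.IsDec 0 a ∧ σ.NoFix 0 a ∧ σ.IsDec a n).card

open Classical in
/-- The number of derangements of `Fin n` that are decreasing on the first `a` and on the last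
`n - a` positions. -/
noncomputable def twoBlockCount (n a : ℕ) : ℕ :=
  (Finset.univ.filter fun σ : Equiv.Perm (Fin n) =>
    σ.IsDec a n ∧ σ.NoFix a n ∧ σ.IsDec 0 a ∧ σ.NoFix 0 a).card

theorem firstBlockCount_zero (b : ℕ) : firstBlockCount b 0 = 1 := by
  classical
  have h := card_isDec_isDec 0 b
  rw [Nat.choose_zero_right, Nat.zero_add] at h
  rw [firstBlockCount, ← h]
  simp only [noFix_of_le le_rfl, true_and]

theorem firstBlockCount_succ (a b : ℕ) :
    firstBlockCount (a + b + 1) (a + 1) + firstBlockCount (a + b) a =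
      (a + b + 1).choose (a + 1) := by
  classical
  have h := card_isDec_isDec (a + 1) b
  rw [Nat.add_right_comm] at h
  rw [← h]
  exact card_noFix_add_card_noFix (Nat.zero_le a) (Nat.le_add_right a b)
    fun p σ _ hp => isDec_insertFixed_of_ge hp

theorem twoBlockCount_self (a : ℕ) : twoBlockCount a a = firstBlockCount a a := by
  classical
  rw [twoBlockCount, firstBlockCount]
  simp only [noFix_of_le le_rfl, isDec_of_le le_rfl, true_and, and_true]

theorem twoBlockCount_succ (a b : ℕ) :
    twoBlockCount (a + (b + 1)) a + twoBlockCount (a + b) a =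
      firstBlockCount (a + (b + 1)) a := by
  classical
  have h := card_noFix_add_card_noFix (P := fun σ => σ.IsDec 0 a ∧ σ.NoFix 0 a)
    (Q := fun σ => σ.IsDec 0 a ∧ σ.NoFix 0 a) (Nat.le_add_right a b) le_rfl fun p σ hp _ =>
    and_congr (isDec_insertFixed_of_le hp) (noFix_insertFixed_of_le hp)
  rw [twoBlockCount, twoBlockCount, firstBlockCount]
  refine (congrArg₂ (· + ·) ?_ ?_).trans (h.trans ?_) <;>
    refine congrArg Finset.card (Finset.ext fun σ => ?_) <;>
    simp only [Finset.mem_filter, ← add_assoc]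
  tauto

theorem firstBlockCount_eq_sum (a b : ℕ) : (firstBlockCount (a + b) a : ℤ) =
    ∑ i ∈ Finset.range (a + 1), (-1 : ℤ) ^ i * ((a - i + b).choose (a - i) : ℤ) := by
  induction a with
  | zero => simp [firstBlockCount_zero]
  | succ a ih =>
    have h := firstBlockCount_succ a b
    rw [Nat.add_right_comm a 1 b, Finset.sum_range_succ']
    simp only [Nat.add_sub_add_right, pow_succ, mul_neg_one, neg_mul, Finset.sum_neg_distrib,
      ← ih, Nat.sub_zero, pow_zero, one_mul, Nat.add_right_comm a 1 b]
    rw [← h]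
    push_cast
    ring

theorem twoBlockCount_eq_sum (a b : ℕ) : (twoBlockCount (a + b) a : ℤ) =
    ∑ k ∈ Finset.range (b + 1), (-1 : ℤ) ^ k * (firstBlockCount (a + (b - k)) a : ℤ) := by
  induction b with
  | zero => simp [twoBlockCount_self]
  | succ b ih =>
    have h := twoBlockCount_succ a b
    rw [Finset.sum_range_succ']
    simp only [Nat.add_sub_add_right, pow_succ, mul_neg_one, neg_mul, Finset.sum_neg_distrib,
      ← ih, Nat.sub_zero, pow_zero, one_mul]
    rw [← h]
    push_cast
    ring

theorem fixCount_eq_zero_iff (σ : Equiv.Perm (Fin n)) : fixCount σ = 0 ↔ σ.NoFix 0 n := by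
  rw [fixCount, Finset.card_eq_zero, Finset.filter_eq_empty_iff]
  constructor
  · intro h i _ _ hi
    refine h (x := i + 1) (Finset.mem_Icc.2 ⟨by omega, i.isLt⟩) ?_
    rw [permToFun, dif_pos ⟨by omega, i.isLt⟩]
    simp [hi]
  · intro h x hx
    have hx' := Finset.mem_Icc.1 hx
    have hne := h ⟨x - 1, by omega⟩ (Nat.zero_le _) (by simp only; omega)
    rw [ne_eq, Fin.ext_iff] at hne
    rw [permToFun, dif_pos hx']
    simp only at hne
    omega

theorem descents_off_iff (σ : Equiv.Perm (Fin n)) {a : ℕ} (ha : a ≤ n) :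
    (∀ j ∈ Finset.Icc 1 (n - 1), j ≠ a → permToFun σ (j + 1) < permToFun σ j) ↔
      σ.IsDec 0 a ∧ σ.IsDec a n := by
  have key : ∀ j ∈ Finset.Icc 1 (n - 1), ∀ i k : Fin n, (i : ℕ) + 1 = j → (k : ℕ) = j →
      (permToFun σ (j + 1) < permToFun σ j ↔ σ k < σ i) := by
    intro j hj i k hi hk
    obtain ⟨h1, h2⟩ := Finset.mem_Icc.1 hj
    have hjn : j < n := by omega
    have hjn' : j - 1 < n := by omega
    obtain rfl : i = ⟨j - 1, hjn'⟩ := Fin.ext (by simp only; omega)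
    obtain rfl : k = ⟨j, hjn⟩ := Fin.ext hk
    rw [permToFun, permToFun, dif_pos ⟨by omega, by omega⟩, dif_pos ⟨by omega, by omega⟩,
      Fin.lt_def, Nat.add_lt_add_iff_right]
    rfl
  rw [isDec_iff_succ, isDec_iff_succ]
  constructor
  · intro h
    refine ⟨fun i j hi hij hj => ?_, fun i j hi hij hj => ?_⟩ <;>
    · have hj' : (j : ℕ) ∈ Finset.Icc 1 (n - 1) := Finset.mem_Icc.2 ⟨by omega, by omega⟩
      exact (key j hj' i j hij.symm rfl).1 (h j hj' (by omega))
  · intro h j hj hja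
    have hj' := Finset.mem_Icc.1 hj
    refine (key j hj ⟨j - 1, by omega⟩ ⟨j, by omega⟩ (by simp only; omega) rfl).2 ?_
    rcases lt_or_gt_of_ne hja with hlt | hgt
    · exact h.1 _ _ (Nat.zero_le _) (by simp only; omega) hlt
    · exact h.2 _ _ (by simp only; omega) (by simp only; omega) (by simp only; omega)

theorem natCard_eq_twoBlockCount (a b : ℕ) :
    Nat.card {π : Equiv.Perm (Fin (a + b)) // fixCount π = 0 ∧
      ∀ j ∈ Finset.Icc 1 (a + b - 1), j ≠ a → permToFun π (j + 1) < permToFun π j} =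
      twoBlockCount (a + b) a := by
  classical
  rw [Nat.card_eq_fintype_card, Fintype.card_subtype, twoBlockCount]
  congr 1
  ext σ
  simp only [Finset.mem_filter, fixCount_eq_zero_iff,
    descents_off_iff σ (Nat.le_add_right a b),
    noFix_append (Nat.zero_le a) (Nat.le_add_right a b)]
  tauto

end Equiv.Perm

/-- Summing over the rectangle `i ≤ a`, `k ≤ b` agrees with summing along its antidiagonals
`i + k = j`. -/
theorem sum_rectangle_choose (a b : ℕ) :
    ∑ k ∈ Finset.range (b + 1), ∑ i ∈ Finset.range (a + 1),
        (-1 : ℤ) ^ (i + k) * ((a - i + (b - k)).choose (a - i) : ℤ) =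
      ∑ j ∈ Finset.range (a + b + 1), ∑ i ∈ Finset.range (j + 1),
        (-1 : ℤ) ^ j * (if i ≤ a then ((a + b - j).choose (a - i) : ℤ) else 0) := by
  rw [Finset.sum_sigma', Finset.sum_sigma']
  refine Finset.sum_of_injOn (fun x => ⟨x.2 + x.1, x.2⟩) ?_ ?_ ?_ ?_
  · rintro ⟨k, i⟩ _ ⟨k', i'⟩ _ h
    simp only [Sigma.mk.injEq, heq_eq_eq] at h ⊢
    omega
  · rintro ⟨k, i⟩ h
    simp only [Finset.coe_sigma, Set.mem_sigma_iff, Finset.mem_coe, Finset.mem_range] at h ⊢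
    omega
  · rintro ⟨j, i⟩ h hnot
    simp only [Finset.mem_sigma, Finset.mem_range] at h ⊢
    split_ifs with hia
    · have hb : b < j - i := by
        by_contra hb
        refine hnot ⟨⟨j - i, i⟩, ?_, ?_⟩
        · simp only [Finset.coe_sigma, Set.mem_sigma_iff, Finset.mem_coe, Finset.mem_range]
          constructor <;> omega
        · simp only [Sigma.mk.injEq, heq_eq_eq, and_true]
          omega
      have hlt : a + b - j < a - i := by omega
      simp [Nat.choose_eq_zero_of_lt hlt]
    · simp
  · rintro ⟨k, i⟩ h
    simp only [Finset.mem_sigma, Finset.mem_range] at h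
    have hi : i ≤ a := by omega
    have hsub : a + b - (i + k) = a - i + (b - k) := by omega
    simp only [if_pos hi, hsub]

/-- Let `M(a,b)` be the number of derangements `π` of `[a+b]` with
`π(j) > π(j+1)` for all `j ∈ [a+b-1]`, `j ≠ a`.  Then
`M(a,b) = Σ_{j=2}^{a+b} Σ_{i=0}^{j} (-1)^j C(a+b-j, a-i)`, where `C(m,r) = 0` for
`r < 0` or `r > m`. -/
theorem Mab_eq_binomial_sum (a b : ℕ) (ha : 0 < a) (hb : 0 < b) :
    (Nat.card {π : Equiv.Perm (Fin (a + b)) //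
        fixCount π = 0 ∧
        ∀ j ∈ Finset.Icc 1 (a + b - 1), j ≠ a →
          permToFun π (j + 1) < permToFun π j} : ℤ)
      = ∑ j ∈ Finset.Icc 2 (a + b), ∑ i ∈ Finset.range (j + 1),
          (-1 : ℤ) ^ j * (if i ≤ a then ((a + b - j).choose (a - i) : ℤ) else 0) := by
  have hsplit := Finset.sum_range_add_sum_Ico (fun j => ∑ i ∈ Finset.range (j + 1),
    (-1 : ℤ) ^ j * (if i ≤ a then ((a + b - j).choose (a - i) : ℤ) else 0))
    (show 2 ≤ a + b + 1 by omega)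
  have hzero : ∑ j ∈ Finset.range 2, ∑ i ∈ Finset.range (j + 1),
      (-1 : ℤ) ^ j * (if i ≤ a then ((a + b - j).choose (a - i) : ℤ) else 0) = 0 := by
    obtain ⟨c, rfl⟩ := Nat.exists_eq_add_one.2 ha
    simp [Finset.sum_range_succ, Nat.add_right_comm c 1 b, Nat.choose_succ_succ]
  have hIcc : Finset.Icc 2 (a + b) = Finset.Ico 2 (a + b + 1) := by
    ext
    simp only [Finset.mem_Icc, Finset.mem_Ico]
    omega
  rw [hzero, zero_add, ← hIcc, ← sum_rectangle_choose] at hsplit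
  rw [hsplit, Equiv.Perm.natCard_eq_twoBlockCount, Equiv.Perm.twoBlockCount_eq_sum]
  refine Finset.sum_congr rfl fun k _ => ?_
  rw [Equiv.Perm.firstBlockCount_eq_sum, Finset.mul_sum]
  refine Finset.sum_congr rfl fun i _ => ?_
  ring
end

section
/- Let n be a positive integer and J a proper subset of [n−1]. Let K_0^J(n) be the set of permutations of [n] that are desarrangements with IDES = J, and K_1^J(n) the set of permutations of [n] with IDES = J and pix = 1 (exactly one pixed point), where desarrangement, pix and lec are evaluated on the word σ_1σ_2…σ_n. Then there exists a polynomial Q(s) with nonnegative integer coefficients such that Σ_{σ∈K_0^J(n)} s^{lec σ} − Σ_{σ∈K_1^J(n)} s^{lec σ} = (s − 1)·Q(s) in ℤ[s]. -/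
/-- Split off the maximal weakly decreasing prefix of a list. -/
def decSplit : List ℕ → List ℕ × List ℕ
  | [] => ([], [])
  | [x] => ([x], [])
  | x :: y :: t =>
    if y ≤ x then
      let p := decSplit (y :: t)
      (x :: p.1, p.2)
    else ([x], y :: t)

/-- Helper computing `lec` on the *reversed* word, with fuel.  Reading the word from
the right, hooks are split off one at a time: the maximal weakly increasing suffix
together with the letter just before it forms the last hook of the
hook-factorization, and the number of inversions of a hook `a h₂ … h_r`
(with `a > h₂ ≤ h₃ ≤ ⋯ ≤ h_r`) is the number of letters `h_j < a`. -/
def lecAux : ℕ → List ℕ → ℕ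
  | 0, _ => 0
  | _, [] => 0
  | fuel + 1, r =>
    match (decSplit r).2 with
    | [] => 0
    | a :: r' => ((decSplit r).1.filter fun x => x < a).length + lecAux fuel r'

/-- `lec w`: the sum of the numbers of inversions of the hooks in the
hook-factorization of `w`. -/
def lec (w : List ℕ) : ℕ := lecAux w.length w.reverse

/-- Helper computing `pix` on the *reversed* word, with fuel. -/
def pixAux : ℕ → List ℕ → ℕ
  | 0, r => r.length
  | fuel + 1, r =>
    match (decSplit r).2 with
    | [] => (decSplit r).1.length
    | _ :: r' => pixAux fuel r'

/-- `pix w`: the length of the weakly increasing prefix in the hook-factorization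
of `w`. -/
def pix (w : List ℕ) : ℕ := pixAux w.length w.reverse

/-- A word `w` is a desarrangement if `w₁ > w₂ > ⋯ > w_{2k} ≤ w_{2k+1}` for some
`k ≥ 1`, with the convention `w_{n+1} = ∞` (indices here are 0-based via `getD`). -/
def IsDesarrangement (w : List ℕ) : Prop :=
  ∃ k : ℕ, 1 ≤ k ∧ 2 * k ≤ w.length ∧
    (∀ i : ℕ, i + 2 ≤ 2 * k → w.getD (i + 1) 0 < w.getD i 0) ∧
    (2 * k = w.length ∨ w.getD (2 * k - 1) 0 ≤ w.getD (2 * k) 0)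

/-- The word `σ₁ σ₂ … σ_n` of a permutation of `[n]` (letters in `{1, …, n}`). -/
def wordOf {n : ℕ} (σ : Equiv.Perm (Fin n)) : List ℕ :=
  List.ofFn fun i : Fin n => (σ i : ℕ) + 1

theorem decSplit_append (r : List ℕ) : (decSplit r).1 ++ (decSplit r).2 = r := by
  fun_induction decSplit r with
  | case3 x y t h p ih => exact congrArg (x :: ·) ih
  | _ => rfl

theorem decSplit_snd_length_lt {r : List ℕ} (hr : r ≠ []) :
    (decSplit r).2.length < r.length := by
  fun_induction decSplit r with
  | case1 => exact absurd rfl hr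
  | case2 => simp
  | case3 x y t h p ih =>
    have h1 : p.2.length < (y :: t).length := ih (by simp)
    exact h1.trans (by simp)
  | case4 => simp

theorem decSplit_cons_of_le {x y : ℕ} (t : List ℕ) (h : y ≤ x) :
    decSplit (x :: y :: t) = (x :: (decSplit (y :: t)).1, (decSplit (y :: t)).2) := by
  simp [decSplit, h]

theorem decSplit_cons_of_lt {x y : ℕ} (t : List ℕ) (h : x < y) :
    decSplit (x :: y :: t) = ([x], y :: t) := by
  simp [decSplit, h]

theorem lecAux_eq_of_length_le (k : ℕ) :
    ∀ (m : ℕ) (r : List ℕ), r.length ≤ k → r.length ≤ m → lecAux k r = lecAux m r := by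
  induction k with
  | zero =>
    intro m r hk _
    obtain rfl : r = [] := by simpa using hk
    cases m <;> simp [lecAux]
  | succ k ih =>
    intro m r hk hm
    rcases eq_or_ne r [] with rfl | hr
    · cases m <;> simp [lecAux]
    obtain ⟨m, rfl⟩ : ∃ m', m = m' + 1 :=
      ⟨m - 1, by have := List.length_pos_iff.2 hr; omega⟩
    have hlt := decSplit_snd_length_lt hr
    simp only [lecAux]
    split
    · rfl
    · rename_i heq
      rw [heq, List.length_cons] at hlt
      rw [ih m _ (by omega) (by omega)]

theorem pixAux_eq_of_length_le (k : ℕ) :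
    ∀ (m : ℕ) (r : List ℕ), r.length ≤ k → r.length ≤ m → pixAux k r = pixAux m r := by
  induction k with
  | zero =>
    intro m r hk _
    obtain rfl : r = [] := by simpa using hk
    cases m <;> simp [pixAux, decSplit]
  | succ k ih =>
    intro m r hk hm
    rcases eq_or_ne r [] with rfl | hr
    · cases m <;> simp [pixAux, decSplit]
    obtain ⟨m, rfl⟩ : ∃ m', m = m' + 1 :=
      ⟨m - 1, by have := List.length_pos_iff.2 hr; omega⟩
    have hlt := decSplit_snd_length_lt hr
    simp only [pixAux]
    split
    · rfl
    · rename_i heq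
      rw [heq, List.length_cons] at hlt
      rw [ih m _ (by omega) (by omega)]

/-- `lec` of the reversal of `r`. -/
def revLec (r : List ℕ) : ℕ := lecAux r.length r

/-- `pix` of the reversal of `r`. -/
def revPix (r : List ℕ) : ℕ := pixAux r.length r

theorem lec_eq_revLec (w : List ℕ) : lec w = revLec w.reverse := by
  simp [lec, revLec]

theorem pix_eq_revPix (w : List ℕ) : pix w = revPix w.reverse := by
  simp [pix, revPix]

theorem revLec_of_decSplit_nil {r : List ℕ} (h : (decSplit r).2 = []) : revLec r = 0 := by
  cases r with
  | nil => rfl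
  | cons x t => simp [revLec, lecAux, h]

theorem revPix_of_decSplit_nil {r : List ℕ} (h : (decSplit r).2 = []) :
    revPix r = r.length := by
  cases r with
  | nil => rfl
  | cons x t =>
    have := decSplit_append (x :: t)
    rw [h, List.append_nil] at this
    simp [revPix, pixAux, h, this]

theorem revLec_of_decSplit {r p r' : List ℕ} {a : ℕ} (h : decSplit r = (p, a :: r')) :
    revLec r = (p.filter fun x => x < a).length + revLec r' := by
  cases r with
  | nil => simp [decSplit] at h
  | cons x t =>
    have hlt := decSplit_snd_length_lt (r := x :: t) (by simp)
    simp only [h, List.length_cons] at hlt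
    simp only [revLec, lecAux, h, List.length_cons]
    rw [lecAux_eq_of_length_le _ r'.length r' (by omega) le_rfl]

theorem revPix_of_decSplit {r p r' : List ℕ} {a : ℕ} (h : decSplit r = (p, a :: r')) :
    revPix r = revPix r' := by
  cases r with
  | nil => simp [decSplit] at h
  | cons x t =>
    have hlt := decSplit_snd_length_lt (r := x :: t) (by simp)
    simp only [h, List.length_cons] at hlt
    simp only [revPix, pixAux, h, List.length_cons]
    rw [pixAux_eq_of_length_le _ r'.length r' (by omega) le_rfl]

theorem revLec_cons_of_lt {x y : ℕ} (t : List ℕ) (h : x < y) :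
    revLec (x :: y :: t) = 1 + revLec t := by
  rw [revLec_of_decSplit (decSplit_cons_of_lt t h)]
  simp [h]

theorem revPix_cons_of_lt {x y : ℕ} (t : List ℕ) (h : x < y) :
    revPix (x :: y :: t) = revPix t :=
  revPix_of_decSplit (decSplit_cons_of_lt t h)

/-- Prepending to a reversed word a letter at least as large as its head does not change whether
`revPix` vanishes, and raises `revLec` by at most one. -/
theorem revPix_revLec_cons_of_le {x y : ℕ} (t : List ℕ) (h : y ≤ x) :
    (revPix (x :: y :: t) = 0 ↔ revPix (y :: t) = 0) ∧
      revLec (y :: t) ≤ revLec (x :: y :: t) ∧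
      revLec (x :: y :: t) ≤ 1 + revLec (y :: t) := by
  have hx := decSplit_cons_of_le t h
  rcases hq : decSplit (y :: t) with ⟨p, _ | ⟨a, r'⟩⟩
  · rw [hq] at hx
    have h1 : (decSplit (y :: t)).2 = [] := by rw [hq]
    have h2 : (decSplit (x :: y :: t)).2 = [] := by rw [hx]
    simp [revPix_of_decSplit_nil h1, revPix_of_decSplit_nil h2, revLec_of_decSplit_nil h1,
      revLec_of_decSplit_nil h2]
  · rw [hq] at hx
    rw [revPix_of_decSplit hq, revPix_of_decSplit hx, revLec_of_decSplit hq,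
      revLec_of_decSplit hx, List.filter_cons]
    refine ⟨Iff.rfl, ?_⟩
    split <;> simp only [List.length_cons] <;> omega

theorem revPix_revLec_cons (r : List ℕ) (x : ℕ) (h : ¬ (x :: r).IsChain (· < ·)) :
    (revPix (x :: r) = 0 ↔ revPix r = 0) ∧ revLec r ≤ revLec (x :: r) := by
  match r with
  | [] => simp at h
  | y :: t =>
    rcases le_or_gt y x with hyx | hxy
    · exact ⟨(revPix_revLec_cons_of_le t hyx).1, (revPix_revLec_cons_of_le t hyx).2.1⟩
    rw [revPix_cons_of_lt t hxy, revLec_cons_of_lt t hxy]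
    match t with
    | [] => simp [hxy] at h
    | z :: t' =>
      rcases le_or_gt z y with hzy | hyz
      · exact ⟨(revPix_revLec_cons_of_le t' hzy).1.symm, (revPix_revLec_cons_of_le t' hzy).2.2⟩
      · rw [revPix_cons_of_lt t' hyz, revLec_cons_of_lt t' hyz]
        have ih := revPix_revLec_cons t' z (by simpa [hxy, hyz] using h)
        exact ⟨ih.1, by omega⟩
  termination_by r.length

theorem revPix_eq_zero_iff_even_of_isChain (r : List ℕ) (h : r.IsChain (· < ·)) :
    revPix r = 0 ↔ Even r.length := by
  match r with
  | [] => simp [revPix, pixAux]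
  | [x] => simp [revPix, pixAux, decSplit]
  | x :: y :: t =>
    rw [revPix_cons_of_lt t (by simp_all),
      revPix_eq_zero_iff_even_of_isChain t (by simpa using h.tail.tail)]
    simp [Nat.even_add_one]
  termination_by r.length

theorem revPix_revLec_concat (r : List ℕ) (x : ℕ) :
    (revPix (r ++ [x]) = 1 ↔ revPix r = 0) ∧
      (revPix r = 0 → revLec (r ++ [x]) = revLec r) := by
  match r with
  | [] => simp [revPix, pixAux, revLec, lecAux, decSplit]
  | y :: t =>
    have key : ∀ (s : List ℕ), s ≠ [] →
        ((decSplit s).2 ≠ [] → decSplit (s ++ [x]) = ((decSplit s).1, (decSplit s).2 ++ [x])) ∧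
        ((decSplit s).2 = [] → decSplit (s ++ [x]) = (s ++ [x], []) ∨
          decSplit (s ++ [x]) = (s, [x])) := by
      intro s
      fun_induction decSplit s with
      | case1 => simp
      | case2 y =>
        intro _
        rcases le_or_gt x y with h | h <;> simp [decSplit, h]
      | case3 y z t h p ih =>
        have ih := ih (by simp)
        refine fun _ => ⟨fun h' => ?_, fun h' => ?_⟩
        · have := ih.1 h'
          simp only [List.cons_append] at this ⊢
          rw [decSplit_cons_of_le _ h, this]
        · have := ih.2 h'
          simp only [List.cons_append] at this ⊢
          rw [decSplit_cons_of_le _ h]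
          rcases this with h | h <;> simp [h]
      | case4 y z t h =>
        simp [decSplit, h]
    have key := key (y :: t) (by simp)
    rcases hq : decSplit (y :: t) with ⟨p, _ | ⟨a, r'⟩⟩
    · have h1 : (decSplit (y :: t)).2 = [] := by rw [hq]
      rw [revPix_of_decSplit_nil h1]
      rcases key.2 h1 with h | h
      · rw [revPix_of_decSplit_nil (by rw [h])]
        simp
      · rw [revPix_of_decSplit h]
        simp [revPix, pixAux]
    · have h := key.1 (by rw [hq]; simp)
      rw [hq] at h
      have hlt := decSplit_snd_length_lt (r := y :: t) (by simp)
      rw [hq] at hlt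
      have hlt' : r'.length < (y :: t).length := lt_trans (by simp) hlt
      rw [revPix_of_decSplit h, revPix_of_decSplit hq, revLec_of_decSplit h,
        revLec_of_decSplit hq]
      have ih := revPix_revLec_concat r' x
      simp only [List.append_eq] at ih ⊢
      exact ⟨ih.1, fun h0 => by rw [ih.2 h0]⟩
  termination_by r.length
  decreasing_by exact hlt'

theorem decSplit_map {f : ℕ → ℕ} (hf : StrictMono f) (r : List ℕ) :
    decSplit (r.map f) = ((decSplit r).1.map f, (decSplit r).2.map f) := by
  fun_induction decSplit r with
  | case1 => rfl
  | case2 => rfl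
  | case3 x y t h p ih =>
    simp only [List.map_cons] at ih ⊢
    rw [decSplit_cons_of_le _ (hf.monotone h), ih]
  | case4 x y t h =>
    simp only [List.map_cons]
    rw [decSplit_cons_of_lt _ (hf (not_le.1 h))]
    simp

theorem revPix_revLec_map {f : ℕ → ℕ} (hf : StrictMono f) (r : List ℕ) :
    revPix (r.map f) = revPix r ∧ revLec (r.map f) = revLec r := by
  rcases eq_or_ne r [] with rfl | hr
  · simp
  have hm := decSplit_map hf r
  have hlt := decSplit_snd_length_lt hr
  rcases hq : decSplit r with ⟨p, _ | ⟨a, r'⟩⟩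
  · rw [hq] at hm
    have h1 : (decSplit r).2 = [] := by rw [hq]
    have h2 : (decSplit (r.map f)).2 = [] := by simp [hm]
    simp [revPix_of_decSplit_nil h1, revPix_of_decSplit_nil h2, revLec_of_decSplit_nil h1,
      revLec_of_decSplit_nil h2]
  · rw [hq] at hm hlt
    simp only [List.map_cons] at hm
    have hlt' : r'.length < r.length := lt_trans (by simp) hlt
    have ih := revPix_revLec_map hf r'
    rw [revPix_of_decSplit hq, revPix_of_decSplit hm, revLec_of_decSplit hq,
      revLec_of_decSplit hm, ih.1, ih.2]
    simp [List.filter_map, Function.comp_def, hf.lt_iff_lt]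
  termination_by r.length
  decreasing_by exact hlt'

theorem isChain_gt_iff_getD (w : List ℕ) :
    w.IsChain (· > ·) ↔ ∀ i, i + 1 < w.length → w.getD (i + 1) 0 < w.getD i 0 := by
  rw [List.isChain_iff_getElem]
  refine forall_congr' fun i => forall_congr' fun hi => ?_
  rw [List.getD_eq_getElem _ _ hi, List.getD_eq_getElem _ _ (by omega)]

theorem isDesarrangement_iff_of_isChain {w : List ℕ} (h : w.IsChain (· > ·)) :
    IsDesarrangement w ↔ w ≠ [] ∧ Even w.length := by
  rw [isChain_gt_iff_getD] at h
  constructor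
  · rintro ⟨k, hk, hkw, -, hk'⟩
    refine ⟨by rintro rfl; simp at hkw; omega, ?_⟩
    by_cases he : 2 * k = w.length
    · exact ⟨k, by omega⟩
    · have := h (2 * k - 1) (by omega)
      rw [show 2 * k - 1 + 1 = 2 * k by omega] at this
      omega
  · rintro ⟨hw, k, hk⟩
    have := List.length_pos_iff.2 hw
    exact ⟨k, by omega, by omega, fun i hi => h i (by omega), Or.inl (by omega)⟩

theorem isDesarrangement_concat {w : List ℕ} {x : ℕ} (h : ¬ (w ++ [x]).IsChain (· > ·)) :
    IsDesarrangement (w ++ [x]) ↔ IsDesarrangement w := by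
  have hl : ∀ i, i < w.length → (w ++ [x]).getD i 0 = w.getD i 0 := fun i hi =>
    List.getD_append _ _ _ _ hi
  have hx : (w ++ [x]).getD w.length 0 = x := by simp
  have hlen : (w ++ [x]).length = w.length + 1 := by simp
  rw [isChain_gt_iff_getD, hlen] at h
  constructor
  · rintro ⟨k, hk, hkw, hdec, hk'⟩
    rw [hlen] at hkw hk'
    have hne : 2 * k ≠ w.length + 1 := fun he => h fun i hi => hdec i (by omega)
    refine ⟨k, hk, by omega, fun i hi => ?_, ?_⟩
    · rw [← hl i (by omega), ← hl (i + 1) (by omega)]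
      exact hdec i hi
    · by_cases he : 2 * k = w.length
      · exact Or.inl he
      · rw [← hl _ (by omega), ← hl (2 * k) (by omega)]
        exact Or.inr (hk'.resolve_left hne)
  · rintro ⟨k, hk, hkw, hdec, hk'⟩
    refine ⟨k, hk, by omega, fun i hi => ?_, Or.inr ?_⟩
    · rw [hl i (by omega), hl (i + 1) (by omega)]
      exact hdec i hi
    · by_cases he : 2 * k = w.length
      · by_contra hlt
        refine h fun i hi => ?_
        by_cases hi' : i + 1 = 2 * k
        · rw [hi', show i = 2 * k - 1 by omega]
          exact not_le.1 hlt
        · rw [hl i (by omega), hl (i + 1) (by omega)]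
          exact hdec i (by omega)
      · rw [hl _ (by omega), hl (2 * k) (by omega)]
        exact hk'.resolve_left he

theorem isDesarrangement_iff_pix (w : List ℕ) :
    IsDesarrangement w ↔ w ≠ [] ∧ pix w = 0 := by
  rw [pix_eq_revPix]
  by_cases h : w.IsChain (· > ·)
  · rw [isDesarrangement_iff_of_isChain h,
      revPix_eq_zero_iff_even_of_isChain _ (List.isChain_reverse.2 h), List.length_reverse]
  induction w using List.reverseRecOn with
  | nil => simp at h
  | append_singleton w x ih =>
    have hw : w ≠ [] := by rintro rfl; simp at h
    have hr : ¬ (x :: w.reverse).IsChain (· < ·) := fun hc => h (by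
      rw [← List.isChain_reverse]; simpa using hc)
    rw [isDesarrangement_concat h, List.reverse_concat, (revPix_revLec_cons _ _ hr).1]
    by_cases hc : w.IsChain (· > ·)
    · rw [isDesarrangement_iff_of_isChain hc,
        revPix_eq_zero_iff_even_of_isChain _ (List.isChain_reverse.2 hc), List.length_reverse]
      simp [hw]
    · rw [ih hc]
      simp [hw]

theorem isDesarrangement_concat_iff {w : List ℕ} {x : ℕ} (hw : w ≠ [])
    (h : ¬ (w ++ [x]).IsChain (· > ·)) : IsDesarrangement (w ++ [x]) ↔ pix w = 0 := by
  rw [isDesarrangement_concat h, isDesarrangement_iff_pix, and_iff_right hw]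

theorem lec_le_lec_concat {w : List ℕ} {x : ℕ} (h : ¬ (w ++ [x]).IsChain (· > ·)) :
    lec w ≤ lec (w ++ [x]) := by
  rw [lec_eq_revLec, lec_eq_revLec, List.reverse_concat]
  refine (revPix_revLec_cons _ _ fun hc => h ?_).2
  rw [← List.isChain_reverse]
  simpa using hc

theorem pix_cons_eq_one_iff (x : ℕ) (w : List ℕ) : pix (x :: w) = 1 ↔ pix w = 0 := by
  rw [pix_eq_revPix, pix_eq_revPix, List.reverse_cons]
  exact (revPix_revLec_concat _ _).1

theorem lec_cons_of_pix_eq_zero (x : ℕ) {w : List ℕ} (h : pix w = 0) :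
    lec (x :: w) = lec w := by
  rw [lec_eq_revLec, lec_eq_revLec, List.reverse_cons]
  exact (revPix_revLec_concat _ _).2 (pix_eq_revPix w ▸ h)

theorem pix_map {f : ℕ → ℕ} (hf : StrictMono f) (w : List ℕ) : pix (w.map f) = pix w := by
  rw [pix_eq_revPix, pix_eq_revPix, ← List.map_reverse, (revPix_revLec_map hf _).1]

theorem lec_map {f : ℕ → ℕ} (hf : StrictMono f) (w : List ℕ) : lec (w.map f) = lec w := by
  rw [lec_eq_revLec, lec_eq_revLec, ← List.map_reverse, (revPix_revLec_map hf _).2]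

/-- The set of (1-based) descent positions of a word. -/
def wordDes : List ℕ → Finset ℕ
  | [] => ∅
  | [_] => ∅
  | a :: b :: v =>
    (if b < a then insert 1 else id) ((wordDes (b :: v)).map (addRightEmbedding 1))

theorem mem_wordDes (w : List ℕ) (i : ℕ) :
    i ∈ wordDes w ↔ 1 ≤ i ∧ i < w.length ∧ w.getD i 0 < w.getD (i - 1) 0 := by
  fun_induction wordDes w generalizing i with
  | case1 => simp
  | case2 => simp; omega
  | case3 a b v ih =>
    obtain _ | _ | i := i
    · split <;> simp
    · split <;> simp_all
    · split <;> simp_all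

theorem wordDes_map {f : ℕ → ℕ} (hf : StrictMono f) (w : List ℕ) :
    wordDes (w.map f) = wordDes w := by
  fun_induction wordDes w with
  | case1 => rfl
  | case2 => rfl
  | case3 a b v ih =>
    simp only [List.map_cons, wordDes, hf.lt_iff_lt] at ih ⊢
    rw [ih]

theorem sum_wordDes_insertIdx {β : Type*} [AddCommMonoid β] (M : ℕ) (v : List ℕ)
    (h0 : ∀ a ∈ v, 0 < a) (hM : ∀ a ∈ v, a < M) (g : Finset ℕ → β) :
    ∑ i ∈ Finset.range (v.length + 1), g (wordDes (v.insertIdx i M)) =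
      ∑ i ∈ Finset.range (v.length + 1), g (wordDes (v.insertIdx i 0)) := by
  induction v generalizing g with
  | nil => simp [wordDes]
  | cons a v ih =>
    have ha0 : 0 < a := h0 a (by simp)
    have haM : a < M := hM a (by simp)
    cases v with
    | nil =>
      simp [Finset.sum_range_succ, wordDes, ha0, haM, ha0.not_gt, haM.not_gt, add_comm]
    | cons b v =>
      have hb0 : 0 < b := h0 b (by simp)
      have hbM : b < M := hM b (by simp)
      have ih := ih (fun c hc => h0 c (by simp_all)) (fun c hc => hM c (by simp_all))
        (fun S => g ((if b < a then insert 1 else id) (S.map (addRightEmbedding 1))))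
      simp only [List.length_cons, Finset.sum_range_succ', List.insertIdx_zero,
        List.insertIdx_succ_cons, wordDes, ha0, haM, ha0.not_gt, haM.not_gt,
        hb0, hbM, hb0.not_gt, hbM.not_gt, if_true, if_false, id] at ih ⊢
      split_ifs at ih ⊢
      · rw [add_right_comm, ih]
      · simp only [id] at ih ⊢
        rw [ih]
        exact add_right_comm _ _ _

/-- The permutation sending `p` to `x` whose remaining letters are in the same relative order
as those of `τ`. -/
def insertPerm {m : ℕ} (p x : Fin (m + 1)) (τ : Equiv.Perm (Fin m)) : Equiv.Perm (Fin (m + 1)) :=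
  (finSuccEquiv' p).trans ((Equiv.optionCongr τ).trans (finSuccEquiv' x).symm)

theorem coe_insertPerm {m : ℕ} (p x : Fin (m + 1)) (τ : Equiv.Perm (Fin m)) :
    ⇑(insertPerm p x τ) = p.insertNth x fun i => x.succAbove (τ i) := by
  funext i
  rcases Fin.eq_self_or_eq_succAbove p i with rfl | ⟨j, rfl⟩ <;> simp [insertPerm]

theorem insertPerm_inv {m : ℕ} (p x : Fin (m + 1)) (τ : Equiv.Perm (Fin m)) :
    (insertPerm p x τ)⁻¹ = insertPerm x p τ⁻¹ := by
  rfl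

theorem insertPerm_bijective {m : ℕ} (p : Fin (m + 1)) :
    Function.Bijective fun q : Equiv.Perm (Fin m) × Fin (m + 1) => insertPerm p q.2 q.1 := by
  rw [Fintype.bijective_iff_injective_and_card]
  constructor
  · rintro ⟨τ, x⟩ ⟨τ', x'⟩ h
    have h' : ⇑(insertPerm p x τ) = insertPerm p x' τ' := congrArg _ h
    rw [coe_insertPerm, coe_insertPerm] at h'
    obtain rfl : x = x' := by simpa using congrFun h' p
    congr 1
    ext i
    have := congrFun h' (p.succAbove i)
    simp only [Fin.insertNth_apply_succAbove, Fin.succAbove_right_inj] at this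
    rw [this]
  · simp [Fintype.card_perm, Nat.factorial_succ, mul_comm]

theorem sum_insertPerm {m : ℕ} {β : Type*} [AddCommMonoid β] (p : Fin (m + 1))
    (f : Equiv.Perm (Fin (m + 1)) → β) :
    ∑ σ, f σ = ∑ τ : Equiv.Perm (Fin m), ∑ x : Fin (m + 1), f (insertPerm p x τ) := by
  rw [← (insertPerm_bijective p).sum_comp f, Fintype.sum_prod_type]

theorem ofFn_insertNth {α : Type*} {m : ℕ} (p : Fin (m + 1)) (a : α) (f : Fin m → α) :
    List.ofFn (p.insertNth a f : Fin (m + 1) → α) = (List.ofFn f).insertIdx p a := by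
  induction m with
  | zero =>
    obtain rfl := Fin.fin_one_eq_zero p
    simp
  | succ m ih =>
    cases p using Fin.cases with
    | zero => simp [List.ofFn_succ]
    | succ p =>
      rw [List.ofFn_succ (f := f), Fin.val_succ, List.insertIdx_succ_cons, ← ih p, List.ofFn_succ]
      congr 1
      · congr 1
        funext i
        rcases Fin.eq_self_or_eq_succAbove p i with rfl | ⟨j, rfl⟩
        · simp
        · have := Fin.insertNth_apply_succAbove (α := fun _ => α) p.succ a f j.succ
          rw [Fin.succ_succAbove_succ] at this
          simpa using this

/-- The increasing enumeration of the natural numbers other than `x + 1`. -/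
def skipValue (x v : ℕ) : ℕ := if v ≤ x then v else v + 1

theorem strictMono_skipValue (x : ℕ) : StrictMono (skipValue x) := by
  intro a b h
  unfold skipValue
  split_ifs <;> omega

theorem wordOf_insertPerm {m : ℕ} (p x : Fin (m + 1)) (τ : Equiv.Perm (Fin m)) :
    wordOf (insertPerm p x τ) =
      ((wordOf τ).map (skipValue x)).insertIdx p ((x : ℕ) + 1) := by
  rw [wordOf, wordOf, List.map_ofFn, ← ofFn_insertNth]
  congr 1
  funext i
  rw [coe_insertPerm]
  rcases Fin.eq_self_or_eq_succAbove p i with rfl | ⟨j, rfl⟩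
  · simp
  · rw [Fin.insertNth_apply_succAbove, Fin.insertNth_apply_succAbove, Function.comp_apply, skipValue]
    simp only [Fin.succAbove, Fin.lt_def, Fin.val_castSucc, Nat.succ_le_iff]
    split <;> simp

@[simp]
theorem length_wordOf {n : ℕ} (σ : Equiv.Perm (Fin n)) : (wordOf σ).length = n := by
  simp [wordOf]

theorem permToFun_eq_getD {n : ℕ} (σ : Equiv.Perm (Fin n)) {i : ℕ} (h1 : 1 ≤ i) (hn : i ≤ n) :
    permToFun σ i = (wordOf σ).getD (i - 1) 0 := by
  rw [List.getD_eq_getElem _ _ (by simp; omega)]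
  simp [permToFun, wordOf, h1, hn]

theorem desSet_eq_wordDes {n : ℕ} (σ : Equiv.Perm (Fin n)) :
    desSet σ = wordDes (wordOf σ) := by
  ext i
  rw [mem_wordDes, desSet, Finset.mem_filter, Finset.mem_Icc, length_wordOf, and_assoc]
  refine and_congr_right fun h1 => ?_
  rw [show i ≤ n - 1 ↔ i < n by omega]
  refine and_congr_right fun h2 => ?_
  rw [permToFun_eq_getD σ (by omega) (by omega), permToFun_eq_getD σ h1 h2.le,
    Nat.add_sub_cancel]

theorem desSet_inv_eq_Icc_of_isChain {n : ℕ} {σ : Equiv.Perm (Fin n)}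
    (h : (wordOf σ).IsChain (· > ·)) : desSet σ⁻¹ = Finset.Icc 1 (n - 1) := by
  have hanti : StrictAnti σ := by
    rw [List.isChain_iff_pairwise, wordOf, List.pairwise_ofFn] at h
    intro i j hij
    simpa using h hij
  refine Finset.filter_true_of_mem fun i hi => ?_
  rw [Finset.mem_Icc] at hi
  simp only [permToFun]
  rw [dif_pos (by omega), dif_pos (by omega), Nat.add_lt_add_iff_right, ← Fin.lt_def,
    ← hanti.lt_iff_gt]
  simp
  omega

theorem sum_desSet_insertPerm {β : Type*} [AddCommMonoid β] {m : ℕ} (τ : Equiv.Perm (Fin m))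
    (g : Finset ℕ → β) :
    ∑ x, g (desSet (insertPerm x (Fin.last m) τ)) = ∑ x, g (desSet (insertPerm x 0 τ)) := by
  have hpos : ∀ a ∈ wordOf τ, 0 < a ∧ a < m + 1 := by simp [wordOf, List.mem_ofFn]
  have hlast (x : Fin (m + 1)) : desSet (insertPerm x (Fin.last m) τ) =
      wordDes ((wordOf τ).insertIdx x (m + 1)) := by
    rw [desSet_eq_wordDes, wordOf_insertPerm, Fin.val_last]
    congr 2
    refine (List.map_congr_left fun a ha => ?_).trans (List.map_id _)
    exact if_pos (Nat.lt_succ_iff.1 (hpos a ha).2)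
  have hzero (x : Fin (m + 1)) : desSet (insertPerm x 0 τ) =
      wordDes ((wordOf τ).insertIdx x 0) := by
    rw [desSet_eq_wordDes, wordOf_insertPerm, ← wordDes_map (strictMono_id.add_const 1) ((wordOf τ).insertIdx x 0),
      List.map_insertIdx]
    congr 2
    refine List.map_congr_left fun a ha => ?_
    exact if_neg (hpos a ha).1.not_ge
  simp only [hlast, hzero]
  have := sum_wordDes_insertIdx (m + 1) (wordOf τ) (fun a ha => (hpos a ha).1)
    (fun a ha => (hpos a ha).2) g
  rw [length_wordOf] at this
  rw [Fin.sum_univ_eq_sum_range fun i => g (wordDes ((wordOf τ).insertIdx i (m + 1))),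
    Fin.sum_univ_eq_sum_range fun i => g (wordDes ((wordOf τ).insertIdx i 0)), this]

theorem exists_X_pow_sub_X_pow {a b : ℕ} (h : a ≤ b) :
    ∃ Q : Polynomial ℤ, (∀ i, 0 ≤ Q.coeff i) ∧
      (Polynomial.X : Polynomial ℤ) ^ b - Polynomial.X ^ a = (Polynomial.X - 1) * Q := by
  obtain ⟨c, rfl⟩ := Nat.exists_eq_add_of_le h
  refine ⟨∑ i ∈ Finset.range c, Polynomial.X ^ (a + i), fun i => ?_, ?_⟩
  · rw [Polynomial.finsetSum_coeff]
    refine Finset.sum_nonneg fun j _ => ?_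
    rw [Polynomial.coeff_X_pow]
    split <;> simp
  · have := mul_geom_sum (Polynomial.X : Polynomial ℤ) c
    simp only [pow_add, ← Finset.mul_sum]
    linear_combination -(Polynomial.X ^ a : Polynomial ℤ) * this

theorem exists_sum_eq_X_sub_one_mul {ι : Type*} (s : Finset ι) (f : ι → Polynomial ℤ)
    (h : ∀ i ∈ s, ∃ Q : Polynomial ℤ, (∀ k, 0 ≤ Q.coeff k) ∧ f i = (Polynomial.X - 1) * Q) :
    ∃ Q : Polynomial ℤ, (∀ k, 0 ≤ Q.coeff k) ∧ ∑ i ∈ s, f i = (Polynomial.X - 1) * Q := by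
  refine Finset.sum_induction f
    (fun p => ∃ Q : Polynomial ℤ, (∀ k, 0 ≤ Q.coeff k) ∧ p = (Polynomial.X - 1) * Q)
    ?_ ⟨0, by simp, by simp⟩ h
  rintro _ _ ⟨Q, hQ, rfl⟩ ⟨R, hR, rfl⟩
  exact ⟨Q + R, fun k => by simpa using add_nonneg (hQ k) (hR k), by ring⟩

open scoped Classical in
/-- For a proper subset `J ⊂ [n-1]`, let `K₀^J(n)` be the set of
permutations of `[n]` whose word is a desarrangement and with `IDES = J`, and
`K₁^J(n)` the set of permutations of `[n]` with `IDES = J` and `pix = 1`.  Then the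
difference of the `lec`-generating polynomials of `K₀^J(n)` and `K₁^J(n)` is
`(s-1)·Q(s)` for a polynomial `Q` with nonnegative integer coefficients.
(Here `IDES σ = DES σ⁻¹`.) -/
theorem lec_poly_K0_sub_K1 (n : ℕ) (hn : 0 < n) (J : Finset ℕ)
    (hJ : J ⊂ Finset.Icc 1 (n - 1)) :
    ∃ Q : Polynomial ℤ, (∀ i, 0 ≤ Q.coeff i) ∧
      (∑ σ ∈ Finset.univ.filter
          (fun σ : Equiv.Perm (Fin n) =>
            IsDesarrangement (wordOf σ) ∧ desSet σ⁻¹ = J),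
          (Polynomial.X : Polynomial ℤ) ^ lec (wordOf σ))
        - (∑ σ ∈ Finset.univ.filter
            (fun σ : Equiv.Perm (Fin n) => desSet σ⁻¹ = J ∧ pix (wordOf σ) = 1),
            (Polynomial.X : Polynomial ℤ) ^ lec (wordOf σ))
        = (Polynomial.X - 1) * Q := by
  obtain ⟨m, rfl⟩ : ∃ m, n = m + 1 := ⟨n - 1, by omega⟩
  have hm : m ≠ 0 := by
    rintro rfl
    simp at hJ
  rw [Finset.sum_filter, Finset.sum_filter, sum_insertPerm (Fin.last m), sum_insertPerm 0,
    ← Finset.sum_sub_distrib]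
  refine exists_sum_eq_X_sub_one_mul _ _ fun τ _ => ?_
  have hnil : wordOf τ ≠ [] := by
    rw [← List.length_pos_iff, length_wordOf]
    omega
  have hword_zero (x : Fin (m + 1)) : wordOf (insertPerm 0 x τ) =
      ((x : ℕ) + 1) :: (wordOf τ).map (skipValue x) := by
    rw [wordOf_insertPerm, Fin.val_zero, List.insertIdx_zero]
  have hword_last (x : Fin (m + 1)) : wordOf (insertPerm (Fin.last m) x τ) =
      ((wordOf τ).map (skipValue x)) ++ [(x : ℕ) + 1] := by
    rw [wordOf_insertPerm, Fin.val_last]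
    simpa using List.insertIdx_length_self (l := (wordOf τ).map (skipValue x)) (x := (x : ℕ) + 1)
  have hzero : (∑ x, if desSet (insertPerm 0 x τ)⁻¹ = J ∧ pix (wordOf (insertPerm 0 x τ)) = 1 then
        (Polynomial.X : Polynomial ℤ) ^ lec (wordOf (insertPerm 0 x τ)) else 0) =
      ∑ x, if desSet (insertPerm (Fin.last m) x τ)⁻¹ = J then
        (if pix (wordOf τ) = 0 then (Polynomial.X : Polynomial ℤ) ^ lec (wordOf τ) else 0)
        else 0 := by
    simp only [insertPerm_inv]
    rw [sum_desSet_insertPerm τ⁻¹ fun S => if S = J then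
      (if pix (wordOf τ) = 0 then (Polynomial.X : Polynomial ℤ) ^ lec (wordOf τ) else 0) else 0]
    refine Finset.sum_congr rfl fun x _ => ?_
    simp only [hword_zero, pix_cons_eq_one_iff, pix_map (strictMono_skipValue x), ite_and]
    refine if_congr Iff.rfl (ite_congr rfl (fun hp => ?_) fun _ => rfl) rfl
    rw [lec_cons_of_pix_eq_zero _ (by rwa [pix_map (strictMono_skipValue x)]),
      lec_map (strictMono_skipValue x)]
  rw [hzero, ← Finset.sum_sub_distrib]
  refine exists_sum_eq_X_sub_one_mul _ _ fun x _ => ?_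
  by_cases hd : desSet (insertPerm (Fin.last m) x τ)⁻¹ = J
  swap
  · exact ⟨0, by simp, by simp [hd]⟩
  have hchain : ¬ (wordOf (insertPerm (Fin.last m) x τ)).IsChain (· > ·) := fun hc =>
    hJ.ne (hd ▸ desSet_inv_eq_Icc_of_isChain hc)
  rw [hword_last] at hchain ⊢
  rw [isDesarrangement_concat_iff (by simpa using hnil) hchain, pix_map (strictMono_skipValue x)]
  by_cases hp : pix (wordOf τ) = 0
  · simp only [hd, hp, and_self, if_true]
    exact exists_X_pow_sub_X_pow (lec_map (strictMono_skipValue x) (wordOf τ) ▸ lec_le_lec_concat hchain)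
  · exact ⟨0, by simp, by simp [hp]⟩
end
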